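/- arXiv:1310.0497 — 3 statements merged into one kernel-verified Lean document; each statement's English description precedes it below -/
import Mathlib

section
/- Deng–Hou–Yu non-blowup criterion (second part): consider a smooth solution of the 3D incompressible Euler equations on ℝ³ × [0,T). Assume there exists a family of vortex line segments L_t and a time T₀ ∈ [0,T) such that X(L_{t₁},t₁,t₂) ⊇ L_{t₂} for all T₀ < t₁ < t₂ < T (where X(·,t₁,t₂) is the flow map from time t₁ to t₂). Assume ‖ω(·,t)‖_{L^∞} is monotonically increasing in t and ‖ω(·,t)‖_{L^∞(L_t)} ≥ c₀ ‖ω(·,t)‖_{L^∞} for some absolute constant c₀ > 0 when t is sufficiently close to T. If (a) U_ξ(t) + U_n(t) M(t) L(t) ≤ c_A (T−t)^{−A} for some A ∈ (0,1), (b) M(t) L(t) ≤ C₀, and (c) L(t) ≥ c_B (T−t)^B for some B < 1−A, where c_A, c_B, C₀ are absolute constants, then ‖ω(·,t)‖_{L^∞} remains bounded up to time T. -/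
open MeasureTheory Set
open scoped ENNReal RealInnerProductSpace

noncomputable section

/-- ℝ³ with the Euclidean norm. -/
abbrev E3 := EuclideanSpace ℝ (Fin 3)

def e3 (v : Fin 3 → ℝ) : E3 := (WithLp.equiv 2 (Fin 3 → ℝ)).symm v

/-- partial derivative in the `i`-th coordinate direction of a scalar function on ℝ³. -/
def pd3 (i : Fin 3) (f : E3 → ℝ) (x : E3) : ℝ := fderiv ℝ f x (EuclideanSpace.single i 1)

/-- the curl (vorticity) `ω = ∇ × u` of a vector field on ℝ³. -/
def curl3 (u : E3 → E3) (x : E3) : E3 :=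
  e3 ![pd3 1 (fun y => u y 2) x - pd3 2 (fun y => u y 1) x,
      pd3 2 (fun y => u y 0) x - pd3 0 (fun y => u y 2) x,
      pd3 0 (fun y => u y 1) x - pd3 1 (fun y => u y 0) x]

/-- the 3D incompressible Euler equations `u_t + (u·∇)u = -∇p`, `∇·u = 0` hold at time `t`
and point `x`. -/
def EulerEqnAt (u : ℝ → E3 → E3) (p : ℝ → E3 → ℝ) (t : ℝ) (x : E3) : Prop :=
  (∀ i : Fin 3, deriv (fun s => u s x i) t
      + ∑ j : Fin 3, u t x j * pd3 j (fun y => u t y i) x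
      = - pd3 i (fun y => p t y) x)
  ∧ ∑ j : Fin 3, pd3 j (fun y => u t y j) x = 0

/-- the vorticity direction field `ξ = ω/|ω|` of a velocity field `v` (junk value `0`
where `ω = 0`). -/
def xiOf (v : E3 → E3) (x : E3) : E3 := ‖curl3 v x‖⁻¹ • curl3 v x

/-- the divergence `∇·ξ` of the vorticity direction field of the velocity field `v`. -/
def divXi (v : E3 → E3) (x : E3) : ℝ := ∑ i : Fin 3, pd3 i (fun y => xiOf v y i) x

/-- the curvature vector `(ξ·∇)ξ` of the vortex lines of the velocity field `v`. -/
def curvVec (v : E3 → E3) (x : E3) : E3 := fderiv ℝ (xiOf v) x (xiOf v x)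

/-- the curvature `κ = |ξ·∇ξ|` of the vortex lines of `v`. -/
def kappaOf (v : E3 → E3) (x : E3) : ℝ := ‖curvVec v x‖

/-- the unit normal `n` of the vortex lines of `v`. -/
def nOf (v : E3 → E3) (x : E3) : E3 := ‖curvVec v x‖⁻¹ • curvVec v x

/-- `U_ξ(t) = max_{x,y ∈ L} |(u·ξ)(x) − (u·ξ)(y)|`. -/
def Uxi (v : E3 → E3) (L : Set E3) : ℝ :=
  sSup ((fun q : E3 × E3 => |⟪v q.1, xiOf v q.1⟫ - ⟪v q.2, xiOf v q.2⟫|) '' (L ×ˢ L))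

/-- `U_n(t) = max_L |u·n|`. -/
def Un (v : E3 → E3) (L : Set E3) : ℝ := sSup ((fun x => |⟪v x, nOf v x⟫|) '' L)

/-- `M(t) = max(‖∇·ξ‖_{L^∞(L)}, ‖κ‖_{L^∞(L)})`. -/
def Mdhy (v : E3 → E3) (L : Set E3) : ℝ :=
  max (sSup ((fun x => |divXi v x|) '' L)) (sSup ((fun x => kappaOf v x) '' L))

section Flow

variable {E F : Type*} [NormedAddCommGroup E] [NormedSpace ℝ E]
  [NormedAddCommGroup F] [NormedSpace ℝ F]

/-- Two trajectories that start close to each other stay close, the Lipschitz condition being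
required only on the unit tube around one of them. -/
theorem dist_le_of_trajectories_of_lipschitzOn_tube {v : ℝ → E → E} {z₀ z : ℝ → E} {a b : ℝ}
    {K : NNReal} (hv : ∀ t ∈ Icc a b, LipschitzOnWith K (v t) (Metric.closedBall (z₀ t) 1))
    (hz₀ : ∀ t ∈ Icc a b, HasDerivAt z₀ (v t (z₀ t)) t)
    (hz : ∀ t ∈ Icc a b, HasDerivAt z (v t (z t)) t)
    (hd : dist (z a) (z₀ a) * Real.exp (K * (b - a)) < 1) :
    ∀ t ∈ Icc a b, dist (z t) (z₀ t) ≤ dist (z a) (z₀ a) * Real.exp (K * (b - a)) := by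
  have hcz₀ : ContinuousOn z₀ (Icc a b) := fun t ht => (hz₀ t ht).continuousAt.continuousWithinAt
  have hcz : ContinuousOn z (Icc a b) := fun t ht => (hz t ht).continuousAt.continuousWithinAt
  have key : ∀ c ∈ Icc a b, (∀ t ∈ Ico a c, dist (z t) (z₀ t) ≤ 1) →
      ∀ t ∈ Icc a c, dist (z t) (z₀ t) ≤ dist (z a) (z₀ a) * Real.exp (K * (b - a)) := by
    intro c hc h t ht
    have hsub : Icc a c ⊆ Icc a b := Icc_subset_Icc_right hc.2
    have hsub' : Ico a c ⊆ Icc a b := Ico_subset_Icc_self.trans hsub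
    refine (dist_le_of_trajectories_ODE_of_mem (K := K) (s := fun t => Metric.closedBall (z₀ t) 1)
      (fun t ht => hv t (hsub' ht)) (hcz.mono hsub)
      (fun t ht => (hz t (hsub' ht)).hasDerivWithinAt) h (hcz₀.mono hsub)
      (fun t ht => (hz₀ t (hsub' ht)).hasDerivWithinAt) (fun t _ => by simp) le_rfl t ht).trans ?_
    have := ht.2.trans hc.2
    gcongr
  by_contra! hcon
  obtain ⟨t, ht, htd⟩ := hcon
  have hcd : ContinuousOn (fun t => dist (z t) (z₀ t)) (Icc a b) :=
    continuous_dist.comp_continuousOn (hcz.prodMk hcz₀)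
  set S : Set ℝ := Icc a b ∩ (fun t => dist (z t) (z₀ t)) ⁻¹' Ici 1 with hS
  have hSc : IsCompact S := isCompact_Icc.of_isClosed_subset
    (hcd.preimage_isClosed_of_isClosed isClosed_Icc isClosed_Ici) inter_subset_left
  by_cases hne : S.Nonempty
  · obtain ⟨c, hcS, hcmin⟩ := hSc.exists_isLeast hne
    have h1 := key c hcS.1 (fun t ht => by
      by_contra! h
      have := hcmin ⟨⟨ht.1, ht.2.le.trans hcS.1.2⟩, h.le⟩
      exact absurd ht.2 (not_lt.2 this)) c ⟨hcS.1.1, le_rfl⟩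
    have h2 : 1 ≤ dist (z c) (z₀ c) := hcS.2
    linarith
  · have h1 := key b ⟨ht.1.trans ht.2, le_rfl⟩ (fun t ht => by
      by_contra! h
      exact hne ⟨t, ⟨ht.1, ht.2.le⟩, h.le⟩) t ht
    linarith

theorem gronwallBound_mul (c K x : ℝ) :
    gronwallBound c K c x = c * gronwallBound 1 K 1 x := by
  unfold gronwallBound
  split_ifs <;> ring

/-- A family of trajectories is differentiable in its parameter, with the derivative given by the
solution of the linearized equation. -/
theorem hasDerivAt_trajectory_param {v : ℝ → E → E} {v' : ℝ → E → E} {Z : ℝ → ℝ → E} {J : ℝ → E}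
    {a b s₀ C : ℝ} {K : NNReal}
    (hv : ∀ t ∈ Icc a b, LipschitzOnWith K (v t) (Metric.closedBall (Z s₀ t) 1))
    (hv' : ∀ t ∈ Icc a b, ∀ y : E, ‖y‖ ≤ 1 →
      ‖v t (Z s₀ t + y) - v t (Z s₀ t) - v' t y‖ ≤ C * ‖y‖ ^ 2)
    (hv'h : ∀ t ∈ Icc a b, ∀ (c : ℝ) (y : E), v' t (c • y) = c • v' t y)
    (hZ : ∀ s, ∀ t ∈ Icc a b, HasDerivAt (Z s) (v t (Z s t)) t)
    (hJ : ∀ t ∈ Icc a b, HasDerivAt J (v' t (J t)) t)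
    (hJa : HasDerivAt (fun s => Z s a) (J a) s₀) :
    ∀ t ∈ Icc a b, HasDerivAt (fun s => Z s t) (J t) s₀ := by
  intro t ht
  have hab : a ≤ b := ht.1.trans ht.2
  have hcJ : ContinuousOn J (Icc a b) := fun t ht => (hJ t ht).continuousAt.continuousWithinAt
  obtain ⟨B, hB⟩ := isCompact_Icc.exists_bound_of_continuousOn hcJ
  have hB0 : 0 ≤ B := (norm_nonneg _).trans (hB a ⟨le_rfl, hab⟩)
  have hC0 : ∀ y : E, 0 ≤ |C| * ‖y‖ ^ 2 := fun y => by positivity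
  rw [hasDerivAt_iff_isLittleO, Asymptotics.isLittleO_iff]
  intro ε hε
  set G := gronwallBound 1 K 1 (t - a) with hG
  have hGpos : 0 < G + 1 := by
    have h0 : gronwallBound 1 K 1 0 ≤ G :=
      gronwallBound_mono zero_le_one zero_le_one K.2 (sub_nonneg.2 ht.1)
    rw [gronwallBound_x0] at h0
    linarith
  have hε' : 0 < ε / (G + 1) := by positivity
  have e1 := (Asymptotics.isLittleO_iff.1 (hasDerivAt_iff_isLittleO.1 hJa)) hε'
  have hcont : Filter.Tendsto (fun s => |s - s₀|) (nhds s₀) (nhds 0) := by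
    have : Continuous fun s => |s - s₀| := by fun_prop
    simpa using this.tendsto s₀
  have e2 : ∀ᶠ s in nhds s₀, |s - s₀| * B < 1 := by
    have := hcont.mul_const B
    rw [zero_mul] at this
    exact this.eventually_lt_const one_pos
  have e3 : ∀ᶠ s in nhds s₀, |s - s₀| * (|C| * B ^ 2) < ε / (G + 1) := by
    have := hcont.mul_const (|C| * B ^ 2)
    rw [zero_mul] at this
    exact this.eventually_lt_const hε'
  have e4 : ∀ᶠ s in nhds s₀, dist (Z s a) (Z s₀ a) * Real.exp (K * (b - a)) < 1 := by
    have h1 : Filter.Tendsto (fun s => dist (Z s a) (Z s₀ a)) (nhds s₀) (nhds 0) := by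
      have := hJa.continuousAt.dist (continuousAt_const (y := Z s₀ a))
      simpa [ContinuousAt] using this
    have := h1.mul_const (Real.exp (K * (b - a)))
    rw [zero_mul] at this
    exact this.eventually_lt_const one_pos
  filter_upwards [e1, e2, e3, e4] with s h1 h2 h3 h4
  set h := s - s₀ with hh
  have hsmall : ∀ t ∈ Icc a b, ‖h • J t‖ ≤ |h| * B := fun t ht => by
    rw [norm_smul, Real.norm_eq_abs]
    exact mul_le_mul_of_nonneg_left (hB t ht) (abs_nonneg _)
  have hexp : dist (Z s a) (Z s₀ a) * Real.exp (K * (b - a)) ≤ 1 := h4.le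
  have hcZ : ∀ s, ContinuousOn (Z s) (Icc a b) :=
    fun s t ht => (hZ s t ht).continuousAt.continuousWithinAt
  have htube := dist_le_of_trajectories_of_lipschitzOn_tube hv (hZ s₀) (hZ s) h4
  have main := dist_le_of_approx_trajectories_ODE_of_mem (v := v) (K := K)
    (s := fun t => Metric.closedBall (Z s₀ t) 1) (f := Z s) (f' := fun t => v t (Z s t))
    (g := fun t => Z s₀ t + h • J t) (g' := fun t => v t (Z s₀ t) + h • v' t (J t))
    (εf := 0) (εg := ε / (G + 1) * |h|) (δ := ε / (G + 1) * |h|)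
    (fun t ht => hv t (Ico_subset_Icc_self ht)) (hcZ s)
    (fun t ht => (hZ s t (Ico_subset_Icc_self ht)).hasDerivWithinAt) (fun t ht => by simp)
    (fun t ht => (htube t (Ico_subset_Icc_self ht)).trans hexp)
    ((hcZ s₀).add (hcJ.const_smul h))
    (fun t ht => ((hZ s₀ t (Ico_subset_Icc_self ht)).add
      ((hJ t (Ico_subset_Icc_self ht)).const_smul h)).hasDerivWithinAt)
    (fun t ht => by
      have ht' := Ico_subset_Icc_self ht
      have hle := hsmall t ht'
      rw [← hv'h t ht', dist_comm, dist_eq_norm, ← sub_sub]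
      refine (hv' t ht' _ (hle.trans h2.le)).trans ?_
      calc C * ‖h • J t‖ ^ 2 ≤ |C| * (|h| * B) ^ 2 := by
            gcongr
            exact le_abs_self C
        _ = |h| * (|C| * B ^ 2) * |h| := by ring
        _ ≤ _ := by gcongr)
    (fun t ht => by
      have := hsmall t (Ico_subset_Icc_self ht)
      simpa using this.trans h2.le)
    (by
      rw [dist_eq_norm, ← sub_sub]
      simpa using h1) t ht
  rw [zero_add, gronwallBound_mul, dist_eq_norm, ← sub_sub] at main
  refine main.trans ?_
  rw [Real.norm_eq_abs, ← hG]
  calc ε / (G + 1) * |h| * G ≤ ε / (G + 1) * |h| * (G + 1) := by gcongr; linarith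
    _ = ε * |h| := by field_simp

theorem hasDerivAt_comp_const_sub {z : ℝ → E} {z' : E} {t₂ t : ℝ} (h : HasDerivAt z z' (t₂ - t)) :
    HasDerivAt (fun τ => z (t₂ - τ)) (-z') t := by
  simpa [Function.comp_def] using h.scomp t ((hasDerivAt_id t).const_sub t₂)

variable [FiniteDimensional ℝ E]

/-- A `C¹` map on an open slab is uniformly Lipschitz on a compact unit tube. -/
theorem exists_lipschitzOnWith_tube {V : ℝ × E → F} {T₁ T₂ : ℝ} {n : WithTop ℕ∞}
    (hV : ContDiffOn ℝ n V (Ioo T₁ T₂ ×ˢ univ)) (hn : 1 ≤ n) {a b : ℝ} (hab : Icc a b ⊆ Ioo T₁ T₂)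
    {z₀ : ℝ → E} (hz₀ : ContinuousOn z₀ (Icc a b)) :
    ∃ K : NNReal, ∀ t ∈ Icc a b,
      LipschitzOnWith K (fun x => V (t, x)) (Metric.closedBall (z₀ t) 1) := by
  have hO : IsOpen (Ioo T₁ T₂ ×ˢ (univ : Set E)) := isOpen_Ioo.prod isOpen_univ
  have hcD : ContinuousOn (fderiv ℝ V) (Ioo T₁ T₂ ×ˢ univ) := hV.continuousOn_fderiv_of_isOpen hO hn
  have hmap : ContinuousOn (fun q : ℝ × E => (q.1, z₀ q.1 + q.2))
      (Icc a b ×ˢ Metric.closedBall 0 1) := by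
    refine continuousOn_fst.prodMk (ContinuousOn.add ?_ continuousOn_snd)
    exact hz₀.comp continuousOn_fst fun q hq => hq.1
  have hmaps : MapsTo (fun q : ℝ × E => (q.1, z₀ q.1 + q.2))
      (Icc a b ×ˢ Metric.closedBall 0 1) (Ioo T₁ T₂ ×ˢ univ) :=
    fun q hq => ⟨hab hq.1, mem_univ _⟩
  obtain ⟨C, hC⟩ := (isCompact_Icc.prod (isCompact_closedBall (0 : E) 1)).exists_bound_of_continuousOn
    (hcD.comp hmap hmaps)
  refine ⟨C.toNNReal, fun t ht => ?_⟩
  refine (convex_closedBall _ _).lipschitzOnWith_of_nnnorm_hasFDerivWithin_le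
    (f' := fun x => (fderiv ℝ V (t, x)).comp (ContinuousLinearMap.inr ℝ ℝ E)) (fun x _ => ?_) ?_
  · have h1 : HasFDerivAt V (fderiv ℝ V (t, x)) (t, x) :=
      ((hV.differentiableOn (by positivity)).differentiableAt
        (hO.mem_nhds ⟨hab ht, mem_univ _⟩)).hasFDerivAt
    exact (h1.comp x (hasFDerivAt_prodMk_right t x)).hasFDerivWithinAt
  · intro x hx
    rw [← NNReal.coe_le_coe, coe_nnnorm]
    have h1 := hC (t, x - z₀ t) ⟨ht, by simpa [dist_eq_norm] using hx⟩
    simp only [Function.comp_apply, add_sub_cancel] at h1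
    calc _ ≤ ‖fderiv ℝ V (t, x)‖ * ‖ContinuousLinearMap.inr ℝ ℝ E‖ :=
          ContinuousLinearMap.opNorm_comp_le _ _
      _ ≤ ‖fderiv ℝ V (t, x)‖ * 1 := by
          gcongr
          exact ContinuousLinearMap.norm_inr_le_one ℝ ℝ E
      _ ≤ C := by simpa using h1
      _ ≤ _ := Real.le_coe_toNNReal C

/-- Second-order Taylor estimate for the spatial increments, uniform on a compact unit tube. -/
theorem exists_taylor_bound_tube {V : ℝ × E → F} {T₁ T₂ : ℝ}
    (hV : ContDiffOn ℝ 2 V (Ioo T₁ T₂ ×ˢ univ)) {a b : ℝ} (hab : Icc a b ⊆ Ioo T₁ T₂)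
    {z₀ : ℝ → E} (hz₀ : ContinuousOn z₀ (Icc a b)) :
    ∃ C : ℝ, ∀ t ∈ Icc a b, ∀ y : E, ‖y‖ ≤ 1 →
      ‖V (t, z₀ t + y) - V (t, z₀ t) - fderiv ℝ V (t, z₀ t) (0, y)‖ ≤ C * ‖y‖ ^ 2 := by
  have hO : IsOpen (Ioo T₁ T₂ ×ˢ (univ : Set E)) := isOpen_Ioo.prod isOpen_univ
  obtain ⟨K, hK⟩ := exists_lipschitzOnWith_tube
    (hV.fderiv_of_isOpen (m := 1) hO (by norm_num)) le_rfl hab hz₀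
  refine ⟨K, fun t ht y hy => ?_⟩
  have hmem : ∀ x ∈ Metric.closedBall (z₀ t) ‖y‖, x ∈ Metric.closedBall (z₀ t) 1 :=
    fun x hx => Metric.closedBall_subset_closedBall hy hx
  have hder : ∀ x ∈ Metric.closedBall (z₀ t) ‖y‖, HasFDerivWithinAt (fun x => V (t, x))
      ((fderiv ℝ V (t, x)).comp (ContinuousLinearMap.inr ℝ ℝ E))
      (Metric.closedBall (z₀ t) ‖y‖) x := by
    intro x _
    have h1 : HasFDerivAt V (fderiv ℝ V (t, x)) (t, x) :=
      ((hV.differentiableOn (by norm_num)).differentiableAt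
        (hO.mem_nhds ⟨hab ht, mem_univ _⟩)).hasFDerivAt
    exact (h1.comp x (hasFDerivAt_prodMk_right t x)).hasFDerivWithinAt
  have hbd : ∀ x ∈ Metric.closedBall (z₀ t) ‖y‖,
      ‖(fderiv ℝ V (t, x)).comp (ContinuousLinearMap.inr ℝ ℝ E) -
        (fderiv ℝ V (t, z₀ t)).comp (ContinuousLinearMap.inr ℝ ℝ E)‖ ≤ K * ‖y‖ := by
    intro x hx
    rw [← ContinuousLinearMap.sub_comp]
    calc _ ≤ ‖fderiv ℝ V (t, x) - fderiv ℝ V (t, z₀ t)‖ * ‖ContinuousLinearMap.inr ℝ ℝ E‖ :=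
          ContinuousLinearMap.opNorm_comp_le _ _
      _ ≤ ‖fderiv ℝ V (t, x) - fderiv ℝ V (t, z₀ t)‖ * 1 := by
          gcongr
          exact ContinuousLinearMap.norm_inr_le_one ℝ ℝ E
      _ ≤ K * dist x (z₀ t) := by
          rw [mul_one, ← dist_eq_norm]
          exact (hK t ht).dist_le_mul _ (hmem x hx) _ (Metric.mem_closedBall_self zero_le_one)
      _ ≤ _ := by
          gcongr
          exact hx
  have := (convex_closedBall (z₀ t) ‖y‖).norm_image_sub_le_of_norm_hasFDerivWithin_le' hder hbd
    (Metric.mem_closedBall_self (norm_nonneg y)) (y := z₀ t + y) (by simp)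
  simpa [pow_two, mul_assoc] using this

variable {V : ℝ × E → E} {T₁ T₂ : ℝ}

/-- Trajectories of a smooth field depend continuously on their final position, uniformly on
compact time intervals. -/
theorem exists_trajectory_stability (hV : ContDiffOn ℝ 2 V (Ioo T₁ T₂ ×ˢ univ)) {t₁ t₂ : ℝ}
    (hsub : Icc t₁ t₂ ⊆ Ioo T₁ T₂) {z₀ : ℝ → E}
    (hz₀ : ∀ t ∈ Ioo T₁ T₂, HasDerivAt z₀ (V (t, z₀ t)) t) :
    ∃ C r : ℝ, 0 < r ∧ ∀ z : ℝ → E, (∀ t ∈ Ioo T₁ T₂, HasDerivAt z (V (t, z t)) t) →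
      dist (z t₂) (z₀ t₂) < r → ∀ t ∈ Icc t₁ t₂, dist (z t) (z₀ t) ≤ C * dist (z t₂) (z₀ t₂) := by
  obtain ⟨K, hK⟩ := exists_lipschitzOnWith_tube hV (by norm_num) hsub
    (fun t ht => (hz₀ t (hsub ht)).continuousAt.continuousWithinAt)
  have hrev : ∀ t ∈ Icc 0 (t₂ - t₁), t₂ - t ∈ Icc t₁ t₂ := fun t ht =>
    ⟨by linarith [ht.2], by linarith [ht.1]⟩
  refine ⟨Real.exp (K * (t₂ - t₁ - 0)), Real.exp (-(K * (t₂ - t₁ - 0))), Real.exp_pos _,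
    fun z hz hd t ht => ?_⟩
  have := dist_le_of_trajectories_of_lipschitzOn_tube (v := fun τ x => -V (t₂ - τ, x))
    (z₀ := fun τ => z₀ (t₂ - τ)) (z := fun τ => z (t₂ - τ)) (a := 0) (b := t₂ - t₁) (K := K)
    (fun t ht => (hK _ (hrev t ht)).neg)
    (fun t ht => hasDerivAt_comp_const_sub (hz₀ _ (hsub (hrev t ht))))
    (fun t ht => hasDerivAt_comp_const_sub (hz _ (hsub (hrev t ht))))
    (by
      have := mul_lt_mul_of_pos_right hd (Real.exp_pos (K * (t₂ - t₁ - 0)))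
      rw [← Real.exp_add, neg_add_cancel, Real.exp_zero] at this
      simpa using this) (t₂ - t) ⟨by linarith [ht.2], by linarith [ht.1]⟩
  simpa [mul_comm] using this

/-- Two trajectories which agree at the final time agree before it. -/
theorem trajectory_unique (hV : ContDiffOn ℝ 2 V (Ioo T₁ T₂ ×ˢ univ)) {t₁ t₂ : ℝ}
    (hsub : Icc t₁ t₂ ⊆ Ioo T₁ T₂) {z₀ z : ℝ → E}
    (hz₀ : ∀ t ∈ Ioo T₁ T₂, HasDerivAt z₀ (V (t, z₀ t)) t)
    (hz : ∀ t ∈ Ioo T₁ T₂, HasDerivAt z (V (t, z t)) t) (h : z t₂ = z₀ t₂) :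
    ∀ t ∈ Icc t₁ t₂, z t = z₀ t := by
  obtain ⟨C, r, hr, hst⟩ := exists_trajectory_stability hV hsub hz₀
  intro t ht
  have := hst z hz (by simpa [h] using hr) t ht
  rw [h, dist_self, mul_zero] at this
  exact dist_le_zero.1 this

theorem hasDerivAt_trajectory_param_backward (hV : ContDiffOn ℝ 2 V (Ioo T₁ T₂ ×ˢ univ))
    {t₁ t₂ s₀ : ℝ} (hsub : Icc t₁ t₂ ⊆ Ioo T₁ T₂) {Z : ℝ → ℝ → E} {J : ℝ → E}
    (hZ : ∀ s, ∀ t ∈ Ioo T₁ T₂, HasDerivAt (Z s) (V (t, Z s t)) t)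
    (hJ : ∀ t ∈ Ioo T₁ T₂, HasDerivAt J (fderiv ℝ V (t, Z s₀ t) (0, J t)) t)
    (hJ₂ : HasDerivAt (fun s => Z s t₂) (J t₂) s₀) :
    ∀ t ∈ Icc t₁ t₂, HasDerivAt (fun s => Z s t) (J t) s₀ := by
  have hc : ContinuousOn (Z s₀) (Icc t₁ t₂) :=
    fun t ht => (hZ s₀ t (hsub ht)).continuousAt.continuousWithinAt
  obtain ⟨K, hK⟩ := exists_lipschitzOnWith_tube hV (by norm_num) hsub hc
  obtain ⟨C, hC⟩ := exists_taylor_bound_tube hV hsub hc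
  have hrev : ∀ t ∈ Icc 0 (t₂ - t₁), t₂ - t ∈ Icc t₁ t₂ := fun t ht =>
    ⟨by linarith [ht.2], by linarith [ht.1]⟩
  intro t ht
  have := hasDerivAt_trajectory_param (v := fun τ x => -V (t₂ - τ, x))
    (v' := fun τ y => -fderiv ℝ V (t₂ - τ, Z s₀ (t₂ - τ)) (0, y))
    (Z := fun s τ => Z s (t₂ - τ)) (J := fun τ => J (t₂ - τ)) (a := 0) (b := t₂ - t₁) (K := K)
    (C := C) (s₀ := s₀)
    (fun t ht => (hK _ (hrev t ht)).neg)
    (fun t ht y hy => by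
      have := hC _ (hrev t ht) y hy
      rw [← norm_neg] at this
      refine le_trans (le_of_eq (congrArg norm ?_)) this
      abel)
    (fun t ht c y => by
      rw [smul_neg, ← map_smul, Prod.smul_mk, smul_zero])
    (fun s t ht => hasDerivAt_comp_const_sub (hZ s _ (hsub (hrev t ht))))
    (fun t ht => hasDerivAt_comp_const_sub (hJ _ (hsub (hrev t ht))))
    (by simpa using hJ₂) (t₂ - t) ⟨by linarith [ht.2], by linarith [ht.1]⟩
  simpa using this

end Flow

section Vorticity

/-- The derivative of `f` in the direction `w`. -/
def dirD {G : Type*} [NormedAddCommGroup G] [NormedSpace ℝ G] (w : G) (f : G → ℝ) (q : G) : ℝ :=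
  fderiv ℝ f q w

section DirD

variable {G : Type*} [NormedAddCommGroup G] [NormedSpace ℝ G] {O : Set G} {f g : G → ℝ} {q : G}

theorem contDiffOn_dirD (hO : IsOpen O) (hf : ContDiffOn ℝ (⊤ : ℕ∞) f O) (w : G) :
    ContDiffOn ℝ (⊤ : ℕ∞) (dirD w f) O :=
  (hf.fderiv_of_isOpen hO (by simp)).clm_apply contDiffOn_const

theorem differentiableAt_of_smooth (hO : IsOpen O) (hf : ContDiffOn ℝ (⊤ : ℕ∞) f O) (hq : q ∈ O) :
    DifferentiableAt ℝ f q :=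
  (hf.differentiableOn (by simp)).differentiableAt (hO.mem_nhds hq)

theorem dirD_comm (hO : IsOpen O) (hf : ContDiffOn ℝ (⊤ : ℕ∞) f O) (hq : q ∈ O) (v w : G) :
    dirD v (dirD w f) q = dirD w (dirD v f) q := by
  have hd : DifferentiableAt ℝ (fderiv ℝ f) q :=
    ((hf.fderiv_of_isOpen (m := (⊤ : ℕ∞)) hO (by simp)).differentiableOn
      (by simp)).differentiableAt (hO.mem_nhds hq)
  have h : ∀ v w, dirD v (dirD w f) q = fderiv ℝ (fderiv ℝ f) q v w := by
    intro v w
    have := hd.hasFDerivAt.clm_apply (hasFDerivAt_const w q)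
    unfold dirD
    rw [this.fderiv]
    simp
  rw [h, h]
  exact ((hf.contDiffAt (hO.mem_nhds hq)).isSymmSndFDerivAt
    (by rw [minSmoothness_of_isRCLikeNormedField]; exact WithTop.coe_le_coe.2 (le_top (a := (2 : ℕ∞))))) v w

theorem dirD_congr (hO : IsOpen O) (h : EqOn f g O) (hq : q ∈ O) (w : G) :
    dirD w f q = dirD w g q := by
  unfold dirD
  rw [(h.eventuallyEq_of_mem (hO.mem_nhds hq)).fderiv_eq]

theorem dirD_add (hf : DifferentiableAt ℝ f q) (hg : DifferentiableAt ℝ g q) (w : G) :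
    dirD w (fun q => f q + g q) q = dirD w f q + dirD w g q := by
  unfold dirD
  rw [fderiv_fun_add hf hg]
  rfl

theorem dirD_sub (hf : DifferentiableAt ℝ f q) (hg : DifferentiableAt ℝ g q) (w : G) :
    dirD w (fun q => f q - g q) q = dirD w f q - dirD w g q := by
  unfold dirD
  rw [fderiv_fun_sub hf hg]
  rfl

theorem dirD_mul (hf : DifferentiableAt ℝ f q) (hg : DifferentiableAt ℝ g q) (w : G) :
    dirD w (fun q => f q * g q) q = f q * dirD w g q + g q * dirD w f q := by
  unfold dirD
  rw [fderiv_fun_mul hf hg]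
  rfl

theorem dirD_neg (w : G) : dirD w (fun q => -f q) q = -dirD w f q := by
  unfold dirD
  rw [fderiv_fun_neg]
  rfl

end DirD

/-- The spatial coordinate directions of `ℝ × ℝ³`. -/
def spaceDir (j : Fin 3) : ℝ × E3 := (0, EuclideanSpace.single j 1)

/-- The time direction of `ℝ × ℝ³`. -/
def timeDir : ℝ × E3 := (1, 0)

theorem E3_eq_sum (x : E3) : x = ∑ j : Fin 3, x j • EuclideanSpace.single j (1 : ℝ) := by
  ext i
  fin_cases i <;> simp [Fin.sum_univ_three]

theorem dirD_space_eq (f : ℝ × E3 → ℝ) (q : ℝ × E3) (x : E3) :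
    dirD (0, x) f q = ∑ j : Fin 3, x j * dirD (spaceDir j) f q := by
  have h : ((0 : ℝ), x) = ∑ j : Fin 3, x j • spaceDir j := by
    rw [Prod.ext_iff]
    constructor
    · simp [spaceDir, Prod.fst_sum]
    · conv_lhs => rw [E3_eq_sum x]
      simp [spaceDir, Prod.snd_sum]
  unfold dirD
  rw [h, map_sum]
  simp

theorem dirD_material_eq (f : ℝ × E3 → ℝ) (q : ℝ × E3) (x : E3) :
    dirD (1, x) f q = dirD timeDir f q + ∑ j : Fin 3, x j * dirD (spaceDir j) f q := by
  rw [← dirD_space_eq]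
  unfold dirD timeDir
  rw [← map_add]
  simp

variable {T : ℝ} {u : ℝ → E3 → E3} {p : ℝ → E3 → ℝ}

/-- The open space-time slab `(0,T) × ℝ³`. -/
def slab (T : ℝ) : Set (ℝ × E3) := Ioo 0 T ×ˢ univ

theorem isOpen_slab (T : ℝ) : IsOpen (slab T) := isOpen_Ioo.prod isOpen_univ

theorem mem_slab {t : ℝ} (ht : t ∈ Ioo 0 T) (x : E3) : (t, x) ∈ slab T := ⟨ht, mem_univ _⟩

theorem pd3_eq_dirD {f : ℝ × E3 → ℝ} (t : ℝ) (x : E3) (hf : DifferentiableAt ℝ f (t, x))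
    (j : Fin 3) : pd3 j (fun y => f (t, y)) x = dirD (spaceDir j) f (t, x) := by
  have := hf.hasFDerivAt.comp x (hasFDerivAt_prodMk_right t x)
  unfold pd3 dirD spaceDir
  change fderiv ℝ (f ∘ fun y => (t, y)) x _ = _
  rw [this.fderiv]
  simp

theorem deriv_eq_dirD {f : ℝ × E3 → ℝ} {t : ℝ} {x : E3} (hf : DifferentiableAt ℝ f (t, x)) :
    deriv (fun s => f (s, x)) t = dirD timeDir f (t, x) := by
  have := hf.hasFDerivAt.comp_hasDerivAt t ((hasDerivAt_id t).prodMk (hasDerivAt_const t x))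
  exact this.deriv

/-- The `i`-th component of a velocity field as a function on space-time. -/
def velComp (u : ℝ → E3 → E3) (i : Fin 3) (q : ℝ × E3) : ℝ := u q.1 q.2 i

/-- The vorticity as a function on space-time. -/
def vort (u : ℝ → E3 → E3) (q : ℝ × E3) : E3 := curl3 (u q.1) q.2

theorem contDiffOn_velComp (hu : ContDiffOn ℝ (⊤ : ℕ∞) (fun q : ℝ × E3 => u q.1 q.2) (slab T))
    (i : Fin 3) : ContDiffOn ℝ (⊤ : ℕ∞) (velComp u i) (slab T) :=
  contDiffOn_euclidean.1 hu i

/-- The components of the vorticity in terms of space-time derivatives. -/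
theorem vort_comp (hu : ContDiffOn ℝ (⊤ : ℕ∞) (fun q : ℝ × E3 => u q.1 q.2) (slab T))
    {q : ℝ × E3} (hq : q ∈ slab T) :
    vort u q 0 = dirD (spaceDir 1) (velComp u 2) q - dirD (spaceDir 2) (velComp u 1) q ∧
    vort u q 1 = dirD (spaceDir 2) (velComp u 0) q - dirD (spaceDir 0) (velComp u 2) q ∧
    vort u q 2 = dirD (spaceDir 0) (velComp u 1) q - dirD (spaceDir 1) (velComp u 0) q := by
  have h : ∀ i j, pd3 j (fun y => u q.1 y i) q.2 = dirD (spaceDir j) (velComp u i) q := fun i j =>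
    pd3_eq_dirD (f := velComp u i) q.1 q.2
      (differentiableAt_of_smooth (isOpen_slab T) (contDiffOn_velComp hu i) hq) j
  unfold vort curl3 e3
  simp [h]

theorem contDiffOn_vort (hu : ContDiffOn ℝ (⊤ : ℕ∞) (fun q : ℝ × E3 => u q.1 q.2) (slab T)) :
    ContDiffOn ℝ (⊤ : ℕ∞) (vort u) (slab T) := by
  have h : ∀ i j, ContDiffOn ℝ (⊤ : ℕ∞) (dirD (spaceDir j) (velComp u i)) (slab T) := fun i j =>
    contDiffOn_dirD (isOpen_slab T) (contDiffOn_velComp hu i) _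
  rw [contDiffOn_euclidean]
  intro i
  fin_cases i
  · exact ((h 2 1).sub (h 1 2)).congr fun q hq => (vort_comp hu hq).1
  · exact ((h 0 2).sub (h 2 0)).congr fun q hq => (vort_comp hu hq).2.1
  · exact ((h 1 0).sub (h 0 1)).congr fun q hq => (vort_comp hu hq).2.2

/-- The vorticity is divergence free. -/
theorem div_vort (hu : ContDiffOn ℝ (⊤ : ℕ∞) (fun q : ℝ × E3 => u q.1 q.2) (slab T))
    {q : ℝ × E3} (hq : q ∈ slab T) :
    ∑ i : Fin 3, dirD (spaceDir i) (fun q => vort u q i) q = 0 := by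
  have hO := isOpen_slab T
  have hd : ∀ i j, DifferentiableAt ℝ (dirD (spaceDir j) (velComp u i)) q := fun i j =>
    differentiableAt_of_smooth hO (contDiffOn_dirD hO (contDiffOn_velComp hu i) _) hq
  have hs := fun i => dirD_comm hO (contDiffOn_velComp hu i) hq
  rw [Fin.sum_univ_three, dirD_congr hO (fun q hq => (vort_comp hu hq).1) hq,
    dirD_congr hO (fun q hq => (vort_comp hu hq).2.1) hq,
    dirD_congr hO (fun q hq => (vort_comp hu hq).2.2) hq, dirD_sub (hd _ _) (hd _ _),
    dirD_sub (hd _ _) (hd _ _), dirD_sub (hd _ _) (hd _ _),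
    hs 2 (spaceDir 0) (spaceDir 1), hs 1 (spaceDir 0) (spaceDir 2),
    hs 0 (spaceDir 1) (spaceDir 2)]
  ring

/-- The vorticity equation `ω_t + (u·∇)ω = (ω·∇)u`. -/
theorem vorticity_equation
    (hu : ContDiffOn ℝ (⊤ : ℕ∞) (fun q : ℝ × E3 => u q.1 q.2) (slab T))
    (hp : ContDiffOn ℝ (⊤ : ℕ∞) (fun q : ℝ × E3 => p q.1 q.2) (slab T))
    (heuler : ∀ t ∈ Ioo 0 T, ∀ z : E3, EulerEqnAt u p t z) {q : ℝ × E3} (hq : q ∈ slab T) :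
    fderiv ℝ (vort u) q (1, u q.1 q.2) =
      fderiv ℝ (fun q : ℝ × E3 => u q.1 q.2) q (0, vort u q) := by
  have hO := isOpen_slab T
  have hU := contDiffOn_velComp hu
  have hdU : ∀ i, ∀ q ∈ slab T, DifferentiableAt ℝ (velComp u i) q := fun i q hq =>
    differentiableAt_of_smooth hO (hU i) hq
  have hdD : ∀ i w, ∀ q ∈ slab T, DifferentiableAt ℝ (dirD w (velComp u i)) q := fun i w q hq =>
    differentiableAt_of_smooth hO (contDiffOn_dirD hO (hU i) _) hq
  have hs := fun i => dirD_comm hO (hU i) hq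
  have hsP := dirD_comm hO hp hq
  have hmom : ∀ i, EqOn (fun q => dirD timeDir (velComp u i) q +
      (velComp u 0 q * dirD (spaceDir 0) (velComp u i) q + velComp u 1 q * dirD (spaceDir 1) (velComp u i) q +
        velComp u 2 q * dirD (spaceDir 2) (velComp u i) q))
      (fun q => -dirD (spaceDir i) (fun q : ℝ × E3 => p q.1 q.2) q) (slab T) := by
    intro i q hq
    have := (heuler q.1 hq.1 q.2).1 i
    have e1 := deriv_eq_dirD (f := velComp u i) (t := q.1) (x := q.2) (hdU i q hq)
    have e2 := fun j => pd3_eq_dirD (f := velComp u i) q.1 q.2 (hdU i q hq) j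
    have e3 := pd3_eq_dirD (f := fun q : ℝ × E3 => p q.1 q.2) q.1 q.2
      (differentiableAt_of_smooth hO hp hq) i
    simp only [velComp] at e1 e2 e3
    rw [e1, e3, Fin.sum_univ_three, e2, e2, e2] at this
    exact this
  have hdiv : dirD (spaceDir 0) (velComp u 0) q + dirD (spaceDir 1) (velComp u 1) q +
      dirD (spaceDir 2) (velComp u 2) q = 0 := by
    have := (heuler q.1 hq.1 q.2).2
    have e2 := fun j => pd3_eq_dirD (f := velComp u j) q.1 q.2 (hdU j q hq) j
    simp only [velComp] at e2
    rw [Fin.sum_univ_three, e2, e2, e2] at this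
    exact this
  have hder : ∀ i k, dirD (spaceDir k) (dirD timeDir (velComp u i)) q +
      ((velComp u 0 q * dirD (spaceDir k) (dirD (spaceDir 0) (velComp u i)) q +
          dirD (spaceDir 0) (velComp u i) q * dirD (spaceDir k) (velComp u 0) q) +
        (velComp u 1 q * dirD (spaceDir k) (dirD (spaceDir 1) (velComp u i)) q +
          dirD (spaceDir 1) (velComp u i) q * dirD (spaceDir k) (velComp u 1) q) +
        (velComp u 2 q * dirD (spaceDir k) (dirD (spaceDir 2) (velComp u i)) q +
          dirD (spaceDir 2) (velComp u i) q * dirD (spaceDir k) (velComp u 2) q)) =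
      -dirD (spaceDir k) (dirD (spaceDir i) (fun q : ℝ × E3 => p q.1 q.2)) q := by
    intro i k
    have := dirD_congr hO (hmom i) hq (spaceDir k)
    have hm : ∀ j, DifferentiableAt ℝ (fun q => velComp u j q * dirD (spaceDir j) (velComp u i) q) q :=
      fun j => (hdU j q hq).mul (hdD i _ q hq)
    rw [dirD_neg, dirD_add (hdD i _ q hq) (((hm 0).fun_add (hm 1)).fun_add (hm 2)),
      dirD_add ((hm 0).fun_add (hm 1)) (hm 2), dirD_add (hm 0) (hm 1),
      dirD_mul (hdU 0 q hq) (hdD i _ q hq), dirD_mul (hdU 1 q hq) (hdD i _ q hq),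
      dirD_mul (hdU 2 q hq) (hdD i _ q hq)] at this
    exact this
  have hL : ∀ (V : ℝ × E3 → E3) (w : ℝ × E3) (i : Fin 3), DifferentiableAt ℝ V q →
      fderiv ℝ V q w i = dirD w (fun q => V q i) q := by
    intro V w i hV
    have := (EuclideanSpace.proj i : E3 →L[ℝ] ℝ).hasFDerivAt.comp q hV.hasFDerivAt
    unfold dirD
    change _ = fderiv ℝ ((EuclideanSpace.proj i : E3 →L[ℝ] ℝ) ∘ V) q w
    rw [this.fderiv]
    simp
  have hdW : DifferentiableAt ℝ (vort u) q :=
    ((contDiffOn_vort hu).differentiableOn (by simp)).differentiableAt (hO.mem_nhds hq)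
  have hdV : DifferentiableAt ℝ (fun q : ℝ × E3 => u q.1 q.2) q :=
    (hu.differentiableOn (by simp)).differentiableAt (hO.mem_nhds hq)
  obtain ⟨w0, w1, w2⟩ := vort_comp hu hq
  have hc : ∀ i w, dirD w (fun q : ℝ × E3 => u q.1 q.2 i) q = dirD w (velComp u i) q :=
    fun i w => rfl
  have hcu : ∀ i, u q.1 q.2 i = velComp u i q := fun i => rfl
  ext i
  rw [hL _ _ _ hdW, hL _ _ _ hdV]
  rw [dirD_material_eq, dirD_space_eq, Fin.sum_univ_three, Fin.sum_univ_three]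
  simp only [hc, hcu, w0, w1, w2]
  fin_cases i
  · have e : ∀ w, dirD w (fun q => vort u q 0) q = dirD w (dirD (spaceDir 1) (velComp u 2)) q -
        dirD w (dirD (spaceDir 2) (velComp u 1)) q := fun w => by
      rw [dirD_congr hO (fun q hq => (vort_comp hu hq).1) hq,
        dirD_sub (hdD _ _ _ hq) (hdD _ _ _ hq)]
    have h1 := hder 2 1
    have h2 := hder 1 2
    simp only [Fin.zero_eta, e]
    rw [hs 2 timeDir (spaceDir 1), hs 1 timeDir (spaceDir 2),
      hs 2 (spaceDir 0) (spaceDir 1), hs 2 (spaceDir 2) (spaceDir 1),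
      hs 1 (spaceDir 0) (spaceDir 2), hs 1 (spaceDir 1) (spaceDir 2)]
    rw [hsP] at h1
    linear_combination h1 - h2 -
      (dirD (spaceDir 1) (velComp u 2) q - dirD (spaceDir 2) (velComp u 1) q) * hdiv
  · have e : ∀ w, dirD w (fun q => vort u q 1) q = dirD w (dirD (spaceDir 2) (velComp u 0)) q -
        dirD w (dirD (spaceDir 0) (velComp u 2)) q := fun w => by
      rw [dirD_congr hO (fun q hq => (vort_comp hu hq).2.1) hq,
        dirD_sub (hdD _ _ _ hq) (hdD _ _ _ hq)]
    have h1 := hder 0 2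
    have h2 := hder 2 0
    simp only [Fin.mk_one, e]
    rw [hs 0 timeDir (spaceDir 2), hs 2 timeDir (spaceDir 0),
      hs 0 (spaceDir 1) (spaceDir 2), hs 0 (spaceDir 0) (spaceDir 2),
      hs 2 (spaceDir 1) (spaceDir 0), hs 2 (spaceDir 2) (spaceDir 0)]
    rw [hsP] at h1
    linear_combination h1 - h2 -
      (dirD (spaceDir 2) (velComp u 0) q - dirD (spaceDir 0) (velComp u 2) q) * hdiv
  · have e : ∀ w, dirD w (fun q => vort u q 2) q = dirD w (dirD (spaceDir 0) (velComp u 1)) q -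
        dirD w (dirD (spaceDir 1) (velComp u 0)) q := fun w => by
      rw [dirD_congr hO (fun q hq => (vort_comp hu hq).2.2) hq,
        dirD_sub (hdD _ _ _ hq) (hdD _ _ _ hq)]
    have h1 := hder 1 0
    have h2 := hder 0 1
    simp only [Fin.reduceFinMk, e]
    rw [hs 1 timeDir (spaceDir 0), hs 0 timeDir (spaceDir 1),
      hs 1 (spaceDir 2) (spaceDir 0), hs 1 (spaceDir 1) (spaceDir 0),
      hs 0 (spaceDir 2) (spaceDir 1), hs 0 (spaceDir 0) (spaceDir 1)]
    rw [hsP] at h1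
    linear_combination h1 - h2 -
      (dirD (spaceDir 0) (velComp u 1) q - dirD (spaceDir 1) (velComp u 0) q) * hdiv

end Vorticity

section VortexLines

variable {v : E3 → E3} {x : E3} {L : Set E3}

theorem norm_smul_xiOf (v : E3 → E3) (x : E3) : ‖curl3 v x‖ • xiOf v x = curl3 v x := by
  unfold xiOf
  by_cases h : curl3 v x = 0
  · simp [h]
  · rw [smul_smul, mul_inv_cancel₀ (norm_ne_zero_iff.2 h), one_smul]

theorem norm_smul_nOf (v : E3 → E3) (x : E3) : kappaOf v x • nOf v x = curvVec v x := by
  unfold nOf kappaOf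
  by_cases h : curvVec v x = 0
  · simp [h]
  · rw [smul_smul, mul_inv_cancel₀ (norm_ne_zero_iff.2 h), one_smul]

theorem norm_nOf_le (v : E3 → E3) (x : E3) : ‖nOf v x‖ ≤ 1 := by
  unfold nOf
  rw [norm_smul, norm_inv, norm_norm]
  exact inv_mul_le_one

theorem isOpen_curl_ne_zero (hω : ContDiff ℝ (⊤ : ℕ∞) (curl3 v)) :
    IsOpen {x | curl3 v x ≠ 0} :=
  isOpen_ne_fun hω.continuous continuous_const

theorem contDiffOn_xiOf (hω : ContDiff ℝ (⊤ : ℕ∞) (curl3 v)) :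
    ContDiffOn ℝ (⊤ : ℕ∞) (xiOf v) {x | curl3 v x ≠ 0} :=
  ((hω.contDiffOn.norm ℝ fun _ hx => hx).inv fun _ hx => norm_ne_zero_iff.2 hx).smul
    hω.contDiffOn

theorem differentiableAt_xiOf (hω : ContDiff ℝ (⊤ : ℕ∞) (curl3 v)) (hx : curl3 v x ≠ 0) :
    DifferentiableAt ℝ (xiOf v) x :=
  ((contDiffOn_xiOf hω).differentiableOn (by simp)).differentiableAt
    ((isOpen_curl_ne_zero hω).mem_nhds hx)

theorem continuousOn_curvVec (hω : ContDiff ℝ (⊤ : ℕ∞) (curl3 v)) :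
    ContinuousOn (curvVec v) {x | curl3 v x ≠ 0} :=
  ((contDiffOn_xiOf hω).continuousOn_fderiv_of_isOpen (isOpen_curl_ne_zero hω) (by simp)).clm_apply
    (contDiffOn_xiOf hω).continuousOn

theorem continuousOn_divXi (hω : ContDiff ℝ (⊤ : ℕ∞) (curl3 v)) :
    ContinuousOn (divXi v) {x | curl3 v x ≠ 0} := by
  unfold divXi pd3
  refine continuousOn_finsetSum _ fun i _ => ?_
  exact ((contDiffOn_euclidean.1 (contDiffOn_xiOf hω) i).continuousOn_fderiv_of_isOpen
    (isOpen_curl_ne_zero hω) (by simp)).clm_apply continuousOn_const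

theorem fderiv_norm_curl_xiOf (hω : ContDiff ℝ (⊤ : ℕ∞) (curl3 v))
    (hdiv : ∑ i : Fin 3, pd3 i (fun y => curl3 v y i) x = 0) (hx : curl3 v x ≠ 0) :
    fderiv ℝ (fun y => ‖curl3 v y‖) x (xiOf v x) = -(divXi v x * ‖curl3 v x‖) := by
  have hn : DifferentiableAt ℝ (fun y => ‖curl3 v y‖) x :=
    (hω.differentiable (by simp) x).norm ℝ hx
  have hξ : ∀ i, DifferentiableAt ℝ (fun y => xiOf v y i) x := fun i =>
    differentiableAt_euclidean.1 (differentiableAt_xiOf hω hx) i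
  have h : ∀ i, pd3 i (fun y => curl3 v y i) x =
      ‖curl3 v x‖ * pd3 i (fun y => xiOf v y i) x + xiOf v x i * pd3 i (fun y => ‖curl3 v y‖) x := by
    intro i
    have e : (fun y => curl3 v y i) = fun y => ‖curl3 v y‖ * xiOf v y i := by
      ext y
      conv_lhs => rw [← norm_smul_xiOf v y]
      simp
    unfold pd3
    rw [e, fderiv_fun_mul hn (hξ i)]
    rfl
  simp_rw [h] at hdiv
  rw [Finset.sum_add_distrib, ← Finset.mul_sum] at hdiv
  have e : fderiv ℝ (fun y => ‖curl3 v y‖) x (xiOf v x) =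
      ∑ i, xiOf v x i * pd3 i (fun y => ‖curl3 v y‖) x := by
    conv_lhs => rw [E3_eq_sum (xiOf v x), map_sum]
    simp [pd3]
  rw [e]
  unfold divXi
  linarith

theorem hasDerivAt_norm_curl_along (hω : ContDiff ℝ (⊤ : ℕ∞) (curl3 v))
    (hdiv : ∀ x, ∑ i : Fin 3, pd3 i (fun y => curl3 v y i) x = 0) {z : ℝ → E3} {s c : ℝ}
    (hz : HasDerivAt z (c • xiOf v (z s)) s) (hx : curl3 v (z s) ≠ 0) :
    HasDerivAt (fun s => Real.log ‖curl3 v (z s)‖) (-(divXi v (z s) * c)) s := by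
  have hn : DifferentiableAt ℝ (fun y => ‖curl3 v y‖) (z s) :=
    (hω.differentiable (by simp) _).norm ℝ hx
  have h := (hn.hasFDerivAt.comp_hasDerivAt s hz).log (norm_ne_zero_iff.2 hx)
  rw [map_smul, fderiv_norm_curl_xiOf hω (hdiv _) hx] at h
  have h0 : ‖curl3 v (z s)‖ ≠ 0 := norm_ne_zero_iff.2 hx
  refine h.congr_deriv ?_
  simp only [Function.comp_apply, smul_eq_mul]
  field_simp

theorem hasDerivAt_inner_xiOf_along (hv : Differentiable ℝ v)
    (hω : ContDiff ℝ (⊤ : ℕ∞) (curl3 v)) {z : ℝ → E3} {s c : ℝ}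
    (hz : HasDerivAt z (c • xiOf v (z s)) s) (hx : curl3 v (z s) ≠ 0) :
    HasDerivAt (fun s => ⟪v (z s), xiOf v (z s)⟫)
      (c * ⟪fderiv ℝ v (z s) (xiOf v (z s)), xiOf v (z s)⟫ + c * ⟪v (z s), curvVec v (z s)⟫) s := by
  have h1 := (hv (z s)).hasFDerivAt.comp_hasDerivAt s hz
  have h2 := (differentiableAt_xiOf hω hx).hasFDerivAt.comp_hasDerivAt s hz
  have h := h1.inner ℝ h2
  simp only [map_smul, Function.comp_apply, inner_smul_left, inner_smul_right, conj_trivial] at h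
  refine h.congr_deriv ?_
  unfold curvVec
  ring

section Bounds

variable (hL : IsCompact L) (hω : ContDiff ℝ (⊤ : ℕ∞) (curl3 v)) (hne : ∀ x ∈ L, curl3 v x ≠ 0)

include hL hω hne

theorem abs_divXi_le_Mdhy (hx : x ∈ L) : |divXi v x| ≤ Mdhy v L :=
  le_max_of_le_left <| le_csSup
    (hL.bddAbove_image ((continuousOn_divXi hω).mono hne).abs) (mem_image_of_mem _ hx)

theorem kappaOf_le_Mdhy (hx : x ∈ L) : kappaOf v x ≤ Mdhy v L :=
  le_max_of_le_right <| le_csSup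
    (hL.bddAbove_image ((continuousOn_curvVec hω).mono hne).norm) (mem_image_of_mem _ hx)

theorem abs_sub_le_Uxi (hv : Continuous v) {y : E3} (hx : x ∈ L) (hy : y ∈ L) :
    |⟪v x, xiOf v x⟫ - ⟪v y, xiOf v y⟫| ≤ Uxi v L := by
  have hc : ContinuousOn (fun x => ⟪v x, xiOf v x⟫) L :=
    hv.continuousOn.inner ((contDiffOn_xiOf hω).continuousOn.mono hne)
  have hc2 : ContinuousOn (fun q : E3 × E3 => |⟪v q.1, xiOf v q.1⟫ - ⟪v q.2, xiOf v q.2⟫|)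
      (L ×ˢ L) :=
    ((hc.comp continuousOn_fst fun q hq => hq.1).sub
      (hc.comp continuousOn_snd fun q hq => hq.2)).abs
  exact le_csSup ((hL.prod hL).bddAbove_image hc2) ⟨(x, y), ⟨hx, hy⟩, rfl⟩

theorem abs_inner_curvVec_le (hv : Continuous v) (hx : x ∈ L) :
    |⟪v x, curvVec v x⟫| ≤ Un v L * Mdhy v L := by
  obtain ⟨C, hC⟩ := hL.exists_bound_of_continuousOn hv.continuousOn
  have hU : |⟪v x, nOf v x⟫| ≤ Un v L := by
    refine le_csSup ⟨C, ?_⟩ (mem_image_of_mem _ hx)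
    rintro _ ⟨y, hy, rfl⟩
    calc |⟪v y, nOf v y⟫| ≤ ‖v y‖ * ‖nOf v y‖ := abs_real_inner_le_norm _ _
      _ ≤ ‖v y‖ * 1 := by gcongr; exact norm_nOf_le v y
      _ ≤ C := by simpa using hC y hy
  have hκ : 0 ≤ kappaOf v x := norm_nonneg _
  rw [← norm_smul_nOf, inner_smul_right, abs_mul, abs_of_nonneg hκ, mul_comm]
  exact mul_le_mul hU (kappaOf_le_Mdhy hL hω hne hx) hκ ((abs_nonneg _).trans hU)

end Bounds

theorem Uxi_nonneg (v : E3 → E3) (L : Set E3) : 0 ≤ Uxi v L :=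
  Real.sSup_nonneg (by rintro _ ⟨q, -, rfl⟩; exact abs_nonneg _)

theorem Un_nonneg (v : E3 → E3) (L : Set E3) : 0 ≤ Un v L :=
  Real.sSup_nonneg (by rintro _ ⟨q, -, rfl⟩; exact abs_nonneg _)

theorem Mdhy_nonneg (v : E3 → E3) (L : Set E3) : 0 ≤ Mdhy v L :=
  le_max_of_le_left (Real.sSup_nonneg (by rintro _ ⟨q, -, rfl⟩; exact abs_nonneg _))

end VortexLines

section Slices

variable {T t : ℝ} {u : ℝ → E3 → E3}

theorem contDiff_curl_slice (hu : ContDiffOn ℝ (⊤ : ℕ∞) (fun q : ℝ × E3 => u q.1 q.2) (slab T))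
    (ht : t ∈ Ioo 0 T) : ContDiff ℝ (⊤ : ℕ∞) (curl3 (u t)) :=
  contDiffOn_univ.1 <| (contDiffOn_vort hu).comp (contDiff_prodMk_right t).contDiffOn
    fun y _ => mem_slab ht y

theorem contDiff_slice (hu : ContDiffOn ℝ (⊤ : ℕ∞) (fun q : ℝ × E3 => u q.1 q.2) (slab T))
    (ht : t ∈ Ioo 0 T) : ContDiff ℝ (⊤ : ℕ∞) (u t) :=
  contDiffOn_univ.1 <| hu.comp (contDiff_prodMk_right t).contDiffOn fun y _ => mem_slab ht y

theorem fderiv_slice (hu : ContDiffOn ℝ (⊤ : ℕ∞) (fun q : ℝ × E3 => u q.1 q.2) (slab T))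
    (ht : t ∈ Ioo 0 T) (x w : E3) :
    fderiv ℝ (u t) x w = fderiv ℝ (fun q : ℝ × E3 => u q.1 q.2) (t, x) (0, w) := by
  have h := ((hu.differentiableOn (by simp)).differentiableAt
    ((isOpen_slab T).mem_nhds (mem_slab ht x))).hasFDerivAt.comp x (hasFDerivAt_prodMk_right t x)
  change fderiv ℝ ((fun q : ℝ × E3 => u q.1 q.2) ∘ fun y => (t, y)) x w = _
  rw [h.fderiv]
  simp

theorem div_curl_slice (hu : ContDiffOn ℝ (⊤ : ℕ∞) (fun q : ℝ × E3 => u q.1 q.2) (slab T))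
    (ht : t ∈ Ioo 0 T) (x : E3) : ∑ i : Fin 3, pd3 i (fun y => curl3 (u t) y i) x = 0 := by
  rw [← div_vort hu (mem_slab ht x)]
  refine Finset.sum_congr rfl fun i _ => ?_
  exact pd3_eq_dirD (f := fun q => vort u q i) t x (differentiableAt_of_smooth (isOpen_slab T)
    (contDiffOn_euclidean.1 (contDiffOn_vort hu) i) (mem_slab ht x)) i

end Slices

section Comparison

/-- A function with `|f'| ≤ k f` changes by a factor of at most `exp (k (b - a))`. -/
theorem exp_comparison {f f' : ℝ → ℝ} {k a b : ℝ} (hab : a ≤ b) (hf : ContinuousOn f (Icc a b))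
    (hf' : ∀ t ∈ Ioo a b, HasDerivAt f (f' t) t) (hk : ∀ t ∈ Ioo a b, |f' t| ≤ k * f t) :
    f b ≤ Real.exp (k * (b - a)) * f a ∧ f a ≤ Real.exp (k * (b - a)) * f b := by
  have hE : ∀ c t : ℝ, HasDerivAt (fun t => Real.exp (c * t)) (Real.exp (c * t) * c) t :=
    fun c t => by simpa using ((hasDerivAt_id t).const_mul c).exp
  have hEc : ∀ c : ℝ, ContinuousOn (fun t => Real.exp (c * t)) (Icc a b) := fun c => by fun_prop
  have hanti : AntitoneOn (fun t => Real.exp (-k * t) * f t) (Icc a b) := by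
    refine antitoneOn_of_hasDerivWithinAt_nonpos (convex_Icc a b) ((hEc (-k)).mul hf)
      (f' := fun t => Real.exp (-k * t) * -k * f t + Real.exp (-k * t) * f' t) ?_ ?_
    · intro t ht
      rw [interior_Icc] at ht
      exact ((hE _ t).mul (hf' t ht)).hasDerivWithinAt
    · intro t ht
      rw [interior_Icc] at ht
      have := (abs_le.1 (hk t ht)).2
      nlinarith [Real.exp_pos (-k * t)]
  have hmono : MonotoneOn (fun t => Real.exp (k * t) * f t) (Icc a b) := by
    refine monotoneOn_of_hasDerivWithinAt_nonneg (convex_Icc a b) ((hEc k).mul hf)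
      (f' := fun t => Real.exp (k * t) * k * f t + Real.exp (k * t) * f' t) ?_ ?_
    · intro t ht
      rw [interior_Icc] at ht
      exact ((hE _ t).mul (hf' t ht)).hasDerivWithinAt
    · intro t ht
      rw [interior_Icc] at ht
      have := (abs_le.1 (hk t ht)).1
      nlinarith [Real.exp_pos (k * t)]
  have h1 := hanti (left_mem_Icc.2 hab) (right_mem_Icc.2 hab) hab
  have h2 := hmono (left_mem_Icc.2 hab) (right_mem_Icc.2 hab) hab
  simp only at h1 h2
  constructor
  · calc f b = Real.exp (k * b) * (Real.exp (-k * b) * f b) := by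
          rw [← mul_assoc, ← Real.exp_add]; simp
      _ ≤ Real.exp (k * b) * (Real.exp (-k * a) * f a) := by gcongr
      _ = _ := by rw [← mul_assoc, ← Real.exp_add]; ring_nf
  · calc f a = Real.exp (-k * a) * (Real.exp (k * a) * f a) := by
          rw [← mul_assoc, ← Real.exp_add]; simp
      _ ≤ Real.exp (-k * a) * (Real.exp (k * b) * f b) := by gcongr
      _ = _ := by rw [← mul_assoc, ← Real.exp_add]; ring_nf

/-- Differentiation under the integral sign for jointly continuous data on a rectangle. -/
theorem hasDerivAt_integral_of_continuousOn_rectangle {g g' : ℝ → ℝ → ℝ} {a b t₁ t₂ : ℝ}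
    (hab : a ≤ b) (hg : ContinuousOn (fun q : ℝ × ℝ => g q.1 q.2) (Icc a b ×ˢ Icc t₁ t₂))
    (hg' : ContinuousOn (fun q : ℝ × ℝ => g' q.1 q.2) (Icc a b ×ˢ Icc t₁ t₂))
    (hd : ∀ s ∈ Icc a b, ∀ t ∈ Icc t₁ t₂, HasDerivAt (g s) (g' s t) t) :
    ContinuousOn (fun t => ∫ s in a..b, g s t) (Icc t₁ t₂) ∧
    ∀ t ∈ Ioo t₁ t₂, HasDerivAt (fun t => ∫ s in a..b, g s t) (∫ s in a..b, g' s t) t := by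
  have hK : IsCompact (Icc a b ×ˢ Icc t₁ t₂) := isCompact_Icc.prod isCompact_Icc
  obtain ⟨C, hC⟩ := hK.exists_bound_of_continuousOn hg
  obtain ⟨C', hC'⟩ := hK.exists_bound_of_continuousOn hg'
  have hI : ∀ s, s ∈ uIoc a b → s ∈ Icc a b := fun s hs => by
    rw [uIoc_of_le hab] at hs
    exact Ioc_subset_Icc_self hs
  have hslice : ∀ f : ℝ → ℝ → ℝ,
      ContinuousOn (fun q : ℝ × ℝ => f q.1 q.2) (Icc a b ×ˢ Icc t₁ t₂) →
      ∀ t ∈ Icc t₁ t₂, IntervalIntegrable (fun s => f s t) volume a b := by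
    intro f hf t ht
    refine ContinuousOn.intervalIntegrable ?_
    rw [uIcc_of_le hab]
    exact hf.comp (f := fun s => (s, t)) (by fun_prop) fun s hs => ⟨hs, ht⟩
  refine ⟨fun t ht => ?_, fun t ht => ?_⟩
  · refine intervalIntegral.continuousWithinAt_of_dominated_interval (bound := fun _ => C)
      ?_ ?_ intervalIntegrable_const ?_
    · filter_upwards [self_mem_nhdsWithin] with r hr
      exact (hslice g hg r hr).aestronglyMeasurable_restrict_uIoc
    · filter_upwards [self_mem_nhdsWithin] with r hr
      exact Filter.Eventually.of_forall fun s hs => hC (s, r) ⟨hI s hs, hr⟩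
    · exact Filter.Eventually.of_forall fun s hs =>
        (hd s (hI s hs) t ht).continuousAt.continuousWithinAt
  · have hm : Ioo t₁ t₂ ∈ nhds t := isOpen_Ioo.mem_nhds ht
    refine (intervalIntegral.hasDerivAt_integral_of_dominated_loc_of_deriv_le
      (F := fun t s => g s t) (F' := fun t s => g' s t)
      (bound := fun _ => C') hm ?_ (hslice g hg t (Ioo_subset_Icc_self ht)) ?_ ?_
      intervalIntegrable_const ?_).2
    · filter_upwards [hm] with r hr
      exact (hslice g hg r (Ioo_subset_Icc_self hr)).aestronglyMeasurable_restrict_uIoc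
    · exact (hslice g' hg' t (Ioo_subset_Icc_self ht)).aestronglyMeasurable_restrict_uIoc
    · exact Filter.Eventually.of_forall fun s hs r hr =>
        hC' (s, r) ⟨hI s hs, Ioo_subset_Icc_self hr⟩
    · exact Filter.Eventually.of_forall fun s hs r hr => hd s (hI s hs) r (Ioo_subset_Icc_self hr)

end Comparison

section Stretching

variable {T : ℝ} {u : ℝ → E3 → E3} {p : ℝ → E3 → ℝ} {Z : ℝ → ℝ → E3} {a b t₁ t₂ : ℝ}

/-- The relative growth `|ω(Z s t, t)| / |ω(Z s t₂, t₂)|` of vorticity along the trajectories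
`Z s`. -/
def stretch (u : ℝ → E3 → E3) (Z : ℝ → ℝ → E3) (t₂ s t : ℝ) : ℝ :=
  ‖curl3 (u t₂) (Z s t₂)‖⁻¹ * ‖curl3 (u t) (Z s t)‖

/-- A family of trajectories of `u` on `[t₁,t₂]`, indexed by `[a,b]`, that is an arc-length
parametrized vortex line at time `t₂`, along which the vorticity does not vanish. -/
structure IsVortexSheet (T : ℝ) (u : ℝ → E3 → E3) (Z : ℝ → ℝ → E3) (a b t₁ t₂ : ℝ) : Prop where
  le_param : a ≤ b
  le_time : t₁ ≤ t₂
  Icc_subset : Icc t₁ t₂ ⊆ Ioo 0 T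
  trajectory : ∀ s, ∀ t ∈ Ioo 0 T, HasDerivAt (Z s) (u t (Z s t)) t
  tangent : ∀ s ∈ Icc a b, HasDerivAt (fun s => Z s t₂) (xiOf (u t₂) (Z s t₂)) s
  ne_zero : ∀ s ∈ Icc a b, ∀ t ∈ Icc t₁ t₂, curl3 (u t) (Z s t) ≠ 0

theorem hasDerivAt_vort_trajectory
    (hu : ContDiffOn ℝ (⊤ : ℕ∞) (fun q : ℝ × E3 => u q.1 q.2) (slab T))
    (hp : ContDiffOn ℝ (⊤ : ℕ∞) (fun q : ℝ × E3 => p q.1 q.2) (slab T))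
    (heuler : ∀ t ∈ Ioo 0 T, ∀ z : E3, EulerEqnAt u p t z) {z : ℝ → E3} {t : ℝ}
    (ht : t ∈ Ioo 0 T) (hz : HasDerivAt z (u t (z t)) t) :
    HasDerivAt (fun t => curl3 (u t) (z t)) (fderiv ℝ (u t) (z t) (curl3 (u t) (z t))) t := by
  have hW : DifferentiableAt ℝ (vort u) (t, z t) :=
    ((contDiffOn_vort hu).differentiableOn (by simp)).differentiableAt
      ((isOpen_slab T).mem_nhds (mem_slab ht _))
  have h := hW.hasFDerivAt.comp_hasDerivAt t ((hasDerivAt_id t).prodMk hz)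
  have e := vorticity_equation hu hp heuler (mem_slab ht (z t))
  simp only at e
  rw [fderiv_slice hu ht]
  exact h.congr_deriv e

namespace IsVortexSheet

variable (h : IsVortexSheet T u Z a b t₁ t₂)
  (hu : ContDiffOn ℝ (⊤ : ℕ∞) (fun q : ℝ × E3 => u q.1 q.2) (slab T))

include h

theorem stretch_pos {s t : ℝ} (hs : s ∈ Icc a b) (ht : t ∈ Icc t₁ t₂) :
    0 < stretch u Z t₂ s t :=
  mul_pos (inv_pos.2 (norm_pos_iff.2 (h.ne_zero s hs t₂ (right_mem_Icc.2 h.le_time))))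
    (norm_pos_iff.2 (h.ne_zero s hs t ht))

theorem stretch_final {s : ℝ} (hs : s ∈ Icc a b) : stretch u Z t₂ s t₂ = 1 :=
  inv_mul_cancel₀ (norm_ne_zero_iff.2 (h.ne_zero s hs t₂ (right_mem_Icc.2 h.le_time)))

include hu

/-- At every time the curve `s ↦ Z s t` is a vortex line with speed `stretch`. -/
theorem hasDerivAt_param (hp : ContDiffOn ℝ (⊤ : ℕ∞) (fun q : ℝ × E3 => p q.1 q.2) (slab T))
    (heuler : ∀ t ∈ Ioo 0 T, ∀ z : E3, EulerEqnAt u p t z) {s t : ℝ} (hs : s ∈ Icc a b)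
    (ht : t ∈ Icc t₁ t₂) :
    HasDerivAt (fun s => Z s t) (stretch u Z t₂ s t • xiOf (u t) (Z s t)) s := by
  have hJ : ∀ t ∈ Ioo 0 T, HasDerivAt
      (fun t => ‖curl3 (u t₂) (Z s t₂)‖⁻¹ • curl3 (u t) (Z s t))
      (fderiv ℝ (fun q : ℝ × E3 => u q.1 q.2) (t, Z s t)
        (0, ‖curl3 (u t₂) (Z s t₂)‖⁻¹ • curl3 (u t) (Z s t))) t := by
    intro t ht
    have := (hasDerivAt_vort_trajectory hu hp heuler ht (h.trajectory s t ht)).const_smul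
      ‖curl3 (u t₂) (Z s t₂)‖⁻¹
    rwa [← map_smul, fderiv_slice hu ht] at this
  have := hasDerivAt_trajectory_param_backward (V := fun q : ℝ × E3 => u q.1 q.2)
    (hu.of_le (by exact WithTop.coe_le_coe.2 (le_top (a := (2 : ℕ∞))))) h.Icc_subset
    h.trajectory hJ (h.tangent s hs) t ht
  refine this.congr_deriv ?_
  rw [stretch, mul_smul, norm_smul_xiOf]

theorem continuousOn_uncurry :
    ContinuousOn (fun q : ℝ × ℝ => Z q.1 q.2) (Icc a b ×ˢ Icc t₁ t₂) := by
  rintro ⟨s₀, τ⟩ ⟨hs₀, hτ⟩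
  obtain ⟨C, r, hr, hC⟩ := exists_trajectory_stability (V := fun q : ℝ × E3 => u q.1 q.2)
    (hu.of_le (by exact WithTop.coe_le_coe.2 (le_top (a := (2 : ℕ∞))))) h.Icc_subset
    (h.trajectory s₀)
  have hc : ContinuousAt (fun q : ℝ × ℝ => Z q.1 t₂) (s₀, τ) :=
    ContinuousAt.comp (f := Prod.fst) (g := fun s => Z s t₂) (h.tangent s₀ hs₀).continuousAt
      continuousAt_fst
  have hc' : ContinuousAt (fun q : ℝ × ℝ => Z s₀ q.2) (s₀, τ) :=
    ContinuousAt.comp (f := Prod.snd) (g := Z s₀)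
      (h.trajectory s₀ τ (h.Icc_subset hτ)).continuousAt continuousAt_snd
  have hlim : ContinuousAt
      (fun q : ℝ × ℝ => C * dist (Z q.1 t₂) (Z s₀ t₂) + dist (Z s₀ q.2) (Z s₀ τ)) (s₀, τ) :=
    (continuousAt_const.mul (hc.dist continuousAt_const)).add (hc'.dist continuousAt_const)
  have hlim' := hlim.tendsto.mono_left
    (nhdsWithin_le_nhds (s := Icc a b ×ˢ Icc t₁ t₂))
  simp only [dist_self, mul_zero, add_zero] at hlim'
  refine tendsto_iff_dist_tendsto_zero.2 (squeeze_zero' (Filter.Eventually.of_forall fun _ =>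
    dist_nonneg) ?_ hlim')
  have hnear := nhdsWithin_le_nhds (s := Icc a b ×ˢ Icc t₁ t₂)
    (hc.preimage_mem_nhds (Metric.ball_mem_nhds _ hr))
  filter_upwards [hnear, self_mem_nhdsWithin] with q hq hq'
  exact (dist_triangle _ _ _).trans
    (add_le_add (hC (Z q.1) (h.trajectory q.1) hq q.2 hq'.2) le_rfl)

theorem continuousOn_vort_uncurry :
    ContinuousOn (fun q : ℝ × ℝ => curl3 (u q.2) (Z q.1 q.2)) (Icc a b ×ˢ Icc t₁ t₂) :=
  (contDiffOn_vort hu).continuousOn.comp (f := fun q : ℝ × ℝ => (q.2, Z q.1 q.2))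
    (continuousOn_snd.prodMk (h.continuousOn_uncurry hu))
    fun _ hq => mem_slab (h.Icc_subset hq.2) _

theorem continuousOn_final_inv :
    ContinuousOn (fun q : ℝ × ℝ => ‖curl3 (u t₂) (Z q.1 t₂)‖⁻¹) (Icc a b ×ˢ Icc t₁ t₂) := by
  refine ContinuousOn.inv₀ (ContinuousOn.norm ?_) fun q hq =>
    norm_ne_zero_iff.2 (h.ne_zero q.1 hq.1 t₂ (right_mem_Icc.2 h.le_time))
  exact (h.continuousOn_vort_uncurry hu).comp (f := fun q : ℝ × ℝ => (q.1, t₂)) (by fun_prop)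
    fun q hq => ⟨hq.1, right_mem_Icc.2 h.le_time⟩

theorem continuousOn_stretch :
    ContinuousOn (fun q : ℝ × ℝ => stretch u Z t₂ q.1 q.2) (Icc a b ×ˢ Icc t₁ t₂) :=
  (h.continuousOn_final_inv hu).mul (h.continuousOn_vort_uncurry hu).norm

theorem continuousOn_xiOf_uncurry :
    ContinuousOn (fun q : ℝ × ℝ => xiOf (u q.2) (Z q.1 q.2)) (Icc a b ×ˢ Icc t₁ t₂) :=
  ((h.continuousOn_vort_uncurry hu).norm.inv₀ fun q hq =>
    norm_ne_zero_iff.2 (h.ne_zero q.1 hq.1 q.2 hq.2)).smul (h.continuousOn_vort_uncurry hu)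

/-- The rate of stretching is the vortex-line component of the strain. -/
theorem hasDerivAt_stretch (hp : ContDiffOn ℝ (⊤ : ℕ∞) (fun q : ℝ × E3 => p q.1 q.2) (slab T))
    (heuler : ∀ t ∈ Ioo 0 T, ∀ z : E3, EulerEqnAt u p t z) {s t : ℝ} (hs : s ∈ Icc a b)
    (ht : t ∈ Icc t₁ t₂) :
    HasDerivAt (stretch u Z t₂ s) (stretch u Z t₂ s t *
      ⟪fderiv ℝ (u t) (Z s t) (xiOf (u t) (Z s t)), xiOf (u t) (Z s t)⟫) t := by
  have ht' := h.Icc_subset ht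
  have hne := h.ne_zero s hs t ht
  have hd := ((hasDerivAt_vort_trajectory hu hp heuler ht'
    (h.trajectory s t ht')).norm_sq.sqrt (by simpa using hne)).const_mul
      ‖curl3 (u t₂) (Z s t₂)‖⁻¹
  simp only [Real.sqrt_sq (norm_nonneg _)] at hd
  refine hd.congr_deriv ?_
  have hn : ‖curl3 (u t) (Z s t)‖ ≠ 0 := norm_ne_zero_iff.2 hne
  unfold stretch xiOf
  rw [map_smul, inner_smul_left, inner_smul_right, real_inner_comm]
  simp only [conj_trivial]
  field_simp

theorem continuousOn_strain :
    ContinuousOn (fun q : ℝ × ℝ =>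
      ⟪fderiv ℝ (u q.2) (Z q.1 q.2) (xiOf (u q.2) (Z q.1 q.2)), xiOf (u q.2) (Z q.1 q.2)⟫)
      (Icc a b ×ˢ Icc t₁ t₂) := by
  have hξ := h.continuousOn_xiOf_uncurry hu
  refine ContinuousOn.inner ?_ hξ
  have hD : ContinuousOn
      (fun q : ℝ × ℝ => fderiv ℝ (fun q : ℝ × E3 => u q.1 q.2) (q.2, Z q.1 q.2))
      (Icc a b ×ˢ Icc t₁ t₂) :=
    (hu.continuousOn_fderiv_of_isOpen (isOpen_slab T) (by simp)).comp
      (f := fun q : ℝ × ℝ => (q.2, Z q.1 q.2))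
      (continuousOn_snd.prodMk (h.continuousOn_uncurry hu))
      fun _ hq => mem_slab (h.Icc_subset hq.2) _
  exact (hD.clm_apply (continuousOn_const.prodMk hξ)).congr fun q hq =>
    fderiv_slice hu (h.Icc_subset hq.2) _ _

variable (hp : ContDiffOn ℝ (⊤ : ℕ∞) (fun q : ℝ × E3 => p q.1 q.2) (slab T))
  (heuler : ∀ t ∈ Ioo 0 T, ∀ z : E3, EulerEqnAt u p t z)

omit hu in
theorem continuousOn_slice {F : Type*} [TopologicalSpace F] {f : ℝ × ℝ → F} {t : ℝ}
    (hf : ContinuousOn f (Icc a b ×ˢ Icc t₁ t₂)) (ht : t ∈ Icc t₁ t₂) :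
    ContinuousOn (fun s => f (s, t)) (uIcc a b) := by
  rw [uIcc_of_le h.le_param]
  exact hf.comp (f := fun s => (s, t)) (by fun_prop) fun s hs => ⟨hs, ht⟩

include hp heuler

/-- The length of the vortex line changes at a rate controlled by `Uxi` and `Un * Mdhy`. -/
theorem abs_integral_stretch_mul_strain_le {t : ℝ} (ht : t ∈ Icc t₁ t₂) {L : Set E3}
    (hL : IsCompact L) (hne : ∀ x ∈ L, curl3 (u t) x ≠ 0) (hZL : ∀ s ∈ Icc a b, Z s t ∈ L) :
    |∫ s in a..b, stretch u Z t₂ s t *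
      ⟪fderiv ℝ (u t) (Z s t) (xiOf (u t) (Z s t)), xiOf (u t) (Z s t)⟫| ≤
    Uxi (u t) L + Un (u t) L * Mdhy (u t) L * ∫ s in a..b, stretch u Z t₂ s t := by
  have hv := contDiff_slice hu (h.Icc_subset ht)
  have hω := contDiff_curl_slice hu (h.Icc_subset ht)
  have hIcc := uIcc_of_le h.le_param
  have hgc := h.continuousOn_slice (h.continuousOn_stretch hu) ht
  have hZc := h.continuousOn_slice (h.continuousOn_uncurry hu) ht
  have hZm : MapsTo (fun s => Z s t) (uIcc a b) {x | curl3 (u t) x ≠ 0} := fun s hs =>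
    hne _ (hZL s (hIcc ▸ hs))
  have h1 : ContinuousOn (fun s => stretch u Z t₂ s t *
      ⟪fderiv ℝ (u t) (Z s t) (xiOf (u t) (Z s t)), xiOf (u t) (Z s t)⟫) (uIcc a b) :=
    hgc.mul (h.continuousOn_slice (h.continuousOn_strain hu) ht)
  have h2 : ContinuousOn (fun s => stretch u Z t₂ s t *
      ⟪u t (Z s t), curvVec (u t) (Z s t)⟫) (uIcc a b) :=
    hgc.mul ((hv.continuous.comp_continuousOn hZc).inner ((continuousOn_curvVec hω).comp hZc hZm))
  have hftc := intervalIntegral.integral_eq_sub_of_hasDerivAt (a := a) (b := b)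
    (fun s hs => hasDerivAt_inner_xiOf_along (hv.differentiable (by simp)) hω
      (h.hasDerivAt_param hu hp heuler (hIcc ▸ hs) ht) (hZm hs))
    (h1.add h2).intervalIntegrable
  rw [intervalIntegral.integral_add h1.intervalIntegrable h2.intervalIntegrable] at hftc
  have hend := abs_sub_le_Uxi hL hω hne hv.continuous
    (hZL b (right_mem_Icc.2 h.le_param)) (hZL a (left_mem_Icc.2 h.le_param))
  have hcurv : |∫ s in a..b, stretch u Z t₂ s t * ⟪u t (Z s t), curvVec (u t) (Z s t)⟫| ≤
      Un (u t) L * Mdhy (u t) L * ∫ s in a..b, stretch u Z t₂ s t := by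
    rw [← intervalIntegral.integral_const_mul, ← Real.norm_eq_abs]
    refine intervalIntegral.norm_integral_le_of_norm_le (μ := volume) h.le_param
      (Filter.Eventually.of_forall fun s hs => ?_)
      ((ContinuousOn.intervalIntegrable hgc).const_mul _)
    have hs' := Ioc_subset_Icc_self hs
    have hpos := h.stretch_pos hs' ht
    rw [Real.norm_eq_abs, abs_mul, abs_of_pos hpos, mul_comm]
    gcongr
    exact abs_inner_curvVec_le hL hω hne hv.continuous (hZL s hs')
  rw [eq_sub_of_add_eq hftc]
  exact (abs_sub _ _).trans (add_le_add hend hcurv)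

/-- The logarithm of the vorticity varies along a vortex line by at most `Mdhy` times its
length. -/
theorem abs_log_sub_log_le {t : ℝ} (ht : t ∈ Icc t₁ t₂) {L : Set E3}
    (hL : IsCompact L) (hne : ∀ x ∈ L, curl3 (u t) x ≠ 0) (hZL : ∀ s ∈ Icc a b, Z s t ∈ L)
    {s s' : ℝ} (hs : s ∈ Icc a b) (hs' : s' ∈ Icc a b) :
    |Real.log ‖curl3 (u t) (Z s' t)‖ - Real.log ‖curl3 (u t) (Z s t)‖| ≤
      Mdhy (u t) L * ∫ s in a..b, stretch u Z t₂ s t := by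
  have hω := contDiff_curl_slice hu (h.Icc_subset ht)
  have hIcc := uIcc_of_le h.le_param
  have hgc := h.continuousOn_slice (h.continuousOn_stretch hu) ht
  have hZc := h.continuousOn_slice (h.continuousOn_uncurry hu) ht
  have hsub : uIcc s s' ⊆ uIcc a b :=
    uIcc_subset_uIcc (hIcc.symm ▸ hs) (hIcc.symm ▸ hs')
  have hZm : MapsTo (fun s => Z s t) (uIcc a b) {x | curl3 (u t) x ≠ 0} := fun s hs =>
    hne _ (hZL s (hIcc ▸ hs))
  have h1 : ContinuousOn (fun s => -(divXi (u t) (Z s t) * stretch u Z t₂ s t)) (uIcc s s') :=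
    ((((continuousOn_divXi hω).comp hZc hZm).mul hgc).neg).mono hsub
  have hftc := intervalIntegral.integral_eq_sub_of_hasDerivAt (a := s) (b := s')
    (fun r hr => hasDerivAt_norm_curl_along hω (div_curl_slice hu (h.Icc_subset ht))
      (h.hasDerivAt_param hu hp heuler (hIcc ▸ hsub hr) ht) (hZm (hsub hr)))
    h1.intervalIntegrable
  have hpos : ∀ r ∈ Icc a b, 0 ≤ Mdhy (u t) L * stretch u Z t₂ r t := fun r hr =>
    mul_nonneg (Mdhy_nonneg _ _) (h.stretch_pos hr ht).le
  rw [← hftc, ← intervalIntegral.integral_const_mul, ← Real.norm_eq_abs]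
  have hg1 : IntervalIntegrable (fun r => Mdhy (u t) L * stretch u Z t₂ r t) volume a b :=
    (hgc.intervalIntegrable).const_mul _
  have hab : uIoc s s' ⊆ uIoc a b := by
    rw [uIoc_of_le h.le_param]
    exact Ioc_subset_Ioc (le_min hs.1 hs'.1) (max_le hs.2 hs'.2)
  refine (intervalIntegral.norm_integral_le_abs_of_norm_le (g := fun r =>
    Mdhy (u t) L * stretch u Z t₂ r t) ?_ (hg1.mono_set hsub)).trans ?_
  · refine (ae_restrict_iff' measurableSet_uIoc).2 (Filter.Eventually.of_forall fun r hr => ?_)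
    have hr' : r ∈ Icc a b := by
      rw [uIoc_of_le h.le_param] at hab
      exact Ioc_subset_Icc_self (hab hr)
    have := h.stretch_pos hr' ht
    rw [norm_neg, Real.norm_eq_abs, abs_mul, abs_of_pos this]
    gcongr
    exact abs_divXi_le_Mdhy hL hω hne (hZL r hr')
  · refine (intervalIntegral.abs_integral_mono_interval hab ?_ hg1).trans ?_
    · refine (ae_restrict_iff' measurableSet_uIoc).2 (Filter.Eventually.of_forall fun r hr => ?_)
      rw [uIoc_of_le h.le_param] at hr
      exact hpos r (Ioc_subset_Icc_self hr)
    · rw [abs_of_nonneg (intervalIntegral.integral_nonneg h.le_param hpos)]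

/-- Control of the growth of vorticity on a vortex line of length at most `ℓ` at the final time,
contained in larger vortex lines satisfying the bounds `Uxi ≤ P`, `Un * Mdhy * ℓ ≤ P` and
`Mdhy ≤ m`. -/
theorem norm_curl_le {L : ℝ → Set E3} {ℓ m P : ℝ} (hab : a < b) (hbℓ : b - a ≤ ℓ)
    (hL : ∀ t ∈ Icc t₁ t₂, IsCompact (L t)) (hne : ∀ t ∈ Icc t₁ t₂, ∀ x ∈ L t, curl3 (u t) x ≠ 0)
    (hZL : ∀ s ∈ Icc a b, ∀ t ∈ Icc t₁ t₂, Z s t ∈ L t)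
    (hU : ∀ t ∈ Icc t₁ t₂, Uxi (u t) (L t) ≤ P)
    (hUM : ∀ t ∈ Icc t₁ t₂, Un (u t) (L t) * Mdhy (u t) (L t) * ℓ ≤ P)
    (hM : ∀ t ∈ Icc t₁ t₂, Mdhy (u t) (L t) ≤ m)
    (hx : P / (b - a) * (t₂ - t₁) ≤ 1 / 4) {s : ℝ} (hs : s ∈ Icc a b) :
    ‖curl3 (u t₂) (Z s t₂)‖ ≤
      Real.exp (4 * (P / (b - a) * (t₂ - t₁)) + 3 * (m * (b - a))) *
        ‖curl3 (u t₁) (Z s t₁)‖ := by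
  have ht1 : t₁ ∈ Icc t₁ t₂ := left_mem_Icc.2 h.le_time
  have ht2 : t₂ ∈ Icc t₁ t₂ := right_mem_Icc.2 h.le_time
  set η := b - a with hη
  set x := P / η * (t₂ - t₁) with hxdef
  have hη0 : 0 < η := sub_pos.2 hab
  have hℓ0 : 0 < ℓ := hη0.trans_le hbℓ
  have hP : 0 ≤ P := (Uxi_nonneg _ _).trans (hU t₁ ht1)
  have hx0 : 0 ≤ x := mul_nonneg (by positivity) (sub_nonneg.2 h.le_time)
  set l : ℝ → ℝ := fun t => ∫ s in a..b, stretch u Z t₂ s t with hl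
  have hl0 : ∀ t ∈ Icc t₁ t₂, 0 ≤ l t := fun t ht =>
    intervalIntegral.integral_nonneg h.le_param fun s hs => (h.stretch_pos hs ht).le
  have hl2 : l t₂ = η := by
    have : l t₂ = ∫ s in a..b, (1 : ℝ) := by
      refine intervalIntegral.integral_congr fun s hs => ?_
      rw [uIcc_of_le h.le_param] at hs
      exact h.stretch_final hs
    rw [this, intervalIntegral.integral_const, smul_eq_mul, mul_one]
  obtain ⟨hlc, hld⟩ := hasDerivAt_integral_of_continuousOn_rectangle h.le_param
    (h.continuousOn_stretch hu) ((h.continuousOn_stretch hu).mul (h.continuousOn_strain hu))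
    (fun s hs t ht => h.hasDerivAt_stretch hu hp heuler hs ht)
  obtain ⟨hle1, hle2⟩ := exp_comparison (f := fun t => η + l t) (k := P / η) h.le_time
    (continuousOn_const.add hlc) (fun t ht => (hld t ht).const_add η) (fun t ht => by
      have ht' := Ioo_subset_Icc_self ht
      refine (h.abs_integral_stretch_mul_strain_le hu hp heuler ht' (hL t ht') (hne t ht')
        fun s hs => hZL s hs t ht').trans ?_
      have h1 : Un (u t) (L t) * Mdhy (u t) (L t) ≤ P / η :=
        ((le_div_iff₀ hℓ0).2 (hUM t ht')).trans (by gcongr)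
      have h2 : P = P / η * η := by field_simp
      rw [mul_add, ← h2]
      exact add_le_add (hU t ht') (mul_le_mul_of_nonneg_right h1 (hl0 t ht')))
  rw [hl2, ← hxdef] at hle1 hle2
  have hexp : Real.exp x ≤ 1 + 2 * x := by
    have h1 := Real.add_one_le_exp (-x)
    have h2 : Real.exp x * Real.exp (-x) = 1 := by rw [← Real.exp_add]; simp
    have h3 := Real.exp_pos x
    nlinarith
  have hl1 : l t₁ ≤ 2 * η := by nlinarith
  have hl1' : η * Real.exp (-(4 * x)) ≤ l t₁ := by
    have h1 := Real.add_one_le_exp (4 * x)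
    have h2 : Real.exp (4 * x) * Real.exp (-(4 * x)) = 1 := by rw [← Real.exp_add]; simp
    have h3 := Real.exp_pos (-(4 * x))
    have h4 : Real.exp (-(4 * x)) ≤ 1 - 2 * x := by
      have : Real.exp (-(4 * x)) * (1 + 4 * x) ≤ 1 := by nlinarith
      refine le_of_mul_le_mul_right (this.trans ?_) (by linarith : 0 < 1 + 4 * x)
      nlinarith
    have h5 : Real.exp x * (1 - x) ≤ 1 := by
      have h6 := Real.add_one_le_exp (-x)
      have h7 : Real.exp x * Real.exp (-x) = 1 := by rw [← Real.exp_add]; simp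
      nlinarith [Real.exp_pos x]
    have h6 : (η + η) * (1 - x) ≤ η + l t₁ :=
      calc (η + η) * (1 - x) ≤ Real.exp x * (η + l t₁) * (1 - x) := by
            gcongr; linarith
        _ = Real.exp x * (1 - x) * (η + l t₁) := by ring
        _ ≤ 1 * (η + l t₁) := mul_le_mul_of_nonneg_right h5 (add_nonneg hη0.le (hl0 t₁ ht1))
        _ = η + l t₁ := one_mul _
    nlinarith
  have hM0 : 0 ≤ m := (Mdhy_nonneg _ _).trans (hM t₁ ht1)
  have hvar : ∀ r ∈ Icc a b, stretch u Z t₂ r t₁ ≤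
      Real.exp (3 * (m * η)) * stretch u Z t₂ s t₁ := by
    intro r hr
    have e1 := (abs_le.1 (h.abs_log_sub_log_le hu hp heuler ht1 (hL _ ht1) (hne _ ht1)
      (fun s hs => hZL s hs _ ht1) hs hr)).2
    have e2 := (abs_le.1 (h.abs_log_sub_log_le hu hp heuler ht2 (hL _ ht2) (hne _ ht2)
      (fun s hs => hZL s hs _ ht2) hs hr)).1
    have e3 : Mdhy (u t₁) (L t₁) * l t₁ ≤ m * (2 * η) := mul_le_mul (hM _ ht1) hl1 (hl0 _ ht1) hM0
    have e4 : Mdhy (u t₂) (L t₂) * l t₂ ≤ m * η := by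
      rw [hl2]; exact mul_le_mul_of_nonneg_right (hM _ ht2) hη0.le
    have hlog : ∀ r ∈ Icc a b, Real.log (stretch u Z t₂ r t₁) =
        Real.log ‖curl3 (u t₁) (Z r t₁)‖ - Real.log ‖curl3 (u t₂) (Z r t₂)‖ := by
      intro r hr
      have n1 := norm_ne_zero_iff.2 (h.ne_zero r hr t₁ ht1)
      have n2 := norm_ne_zero_iff.2 (h.ne_zero r hr t₂ ht2)
      rw [stretch, Real.log_mul (inv_ne_zero n2) n1, Real.log_inv]
      ring
    have hpr := h.stretch_pos hr ht1
    have hps := h.stretch_pos hs ht1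
    rw [← Real.log_le_log_iff hpr (by positivity), Real.log_mul (Real.exp_ne_zero _) hps.ne',
      Real.log_exp, hlog r hr, hlog s hs]
    simp only [hl] at e3 e4
    linarith
  have hfin : l t₁ ≤ η * (Real.exp (3 * (m * η)) * stretch u Z t₂ s t₁) := by
    have := intervalIntegral.integral_mono_on (μ := volume) h.le_param
      (ContinuousOn.intervalIntegrable (h.continuousOn_slice (h.continuousOn_stretch hu) ht1))
      intervalIntegrable_const hvar
    rwa [intervalIntegral.integral_const, smul_eq_mul] at this
  have hstr : Real.exp (-(4 * x)) ≤ Real.exp (3 * (m * η)) * stretch u Z t₂ s t₁ :=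
    le_of_mul_le_mul_left (hl1'.trans hfin) hη0
  have hn2 := norm_pos_iff.2 (h.ne_zero s hs t₂ ht2)
  have hunit : Real.exp (4 * x) * Real.exp (-(4 * x)) = 1 := by rw [← Real.exp_add]; simp
  calc ‖curl3 (u t₂) (Z s t₂)‖
      = ‖curl3 (u t₂) (Z s t₂)‖ * (Real.exp (4 * x) * Real.exp (-(4 * x))) := by
        rw [hunit, mul_one]
    _ ≤ ‖curl3 (u t₂) (Z s t₂)‖ * (Real.exp (4 * x) *
          (Real.exp (3 * (m * η)) * stretch u Z t₂ s t₁)) := by gcongr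
    _ = _ := by
        rw [Real.exp_add, stretch]
        field_simp

end IsVortexSheet

end Stretching

section Iteration

/-- A bound that is multiplied by at most `exp (C (T - t₁) ^ ε)` whenever the distance to `T` is at
most halved stays finite up to `T`. -/
theorem exists_bound_of_dyadic_steps {Q : ℝ → ℝ → Prop} {T C ε δ K₀ : ℝ} (hC : 0 ≤ C)
    (hε : 0 < ε) (hδ : 0 < δ) (hK₀ : 0 ≤ K₀) (hQ : ∀ t K K', K ≤ K' → Q K t → Q K' t)
    (h₀ : Q K₀ (T - δ))
    (hstep : ∀ t₁ t₂ K, T - δ ≤ t₁ → t₁ ≤ t₂ → t₂ < T → (T - t₁) / 2 ≤ T - t₂ → Q K t₁ →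
      Q (Real.exp (C * (T - t₁) ^ ε) * K) t₂) :
    ∃ K, ∀ t ∈ Ico (T - δ) T, Q K t := by
  set r : ℝ := (1 / 2) ^ ε with hr
  have hr0 : 0 ≤ r := by positivity
  have hr1 : r < 1 := Real.rpow_lt_one (by norm_num) (by norm_num) hε
  have hpow : ∀ n : ℕ, (δ * (1 / 2) ^ n) ^ ε = δ ^ ε * r ^ n := fun n => by
    rw [Real.mul_rpow hδ.le (by positivity), hr, ← Real.rpow_natCast, ← Real.rpow_mul (by norm_num),
      mul_comm (n : ℝ), Real.rpow_mul (by norm_num), Real.rpow_natCast]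
  have hle1 : ∀ n : ℕ, (1 / 2 : ℝ) ^ n ≤ 1 := fun n => pow_le_one₀ (by norm_num) (by norm_num)
  set K : ℕ → ℝ := fun n => Real.exp (C * δ ^ ε * ∑ i ∈ Finset.range n, r ^ i) * K₀ with hK
  have hKs : ∀ n, Real.exp (C * (T - (T - δ * (1 / 2) ^ n)) ^ ε) * K n = K (n + 1) := fun n => by
    simp only [hK]
    rw [sub_sub_cancel, hpow, ← mul_assoc, ← Real.exp_add, Finset.sum_range_succ]
    ring_nf
  have hn : ∀ n : ℕ, Q (K n) (T - δ * (1 / 2) ^ n) := by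
    intro n
    induction n with
    | zero => simpa [hK] using h₀
    | succ n ih =>
      have hpn : (0 : ℝ) < (1 / 2) ^ n := by positivity
      rw [← hKs]
      refine hstep _ _ _ ?_ ?_ ?_ ?_ ih
      · nlinarith [hle1 n]
      · rw [pow_succ]; nlinarith
      · rw [pow_succ]; nlinarith
      · rw [pow_succ]; apply le_of_eq; ring
  refine ⟨Real.exp (C * δ ^ ε * (1 - r)⁻¹) * K₀, fun t ht => ?_⟩
  obtain ⟨n, hn1, hn2⟩ := exists_nat_pow_near_of_lt_one (x := (T - t) / δ) (y := 1 / 2)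
    (div_pos (by linarith [ht.2]) hδ) ((div_le_one hδ).2 (by linarith [ht.1])) (by norm_num)
    (by norm_num)
  rw [lt_div_iff₀ hδ, pow_succ] at hn1
  rw [div_le_iff₀ hδ] at hn2
  have hQn := hstep _ t _ (by nlinarith [hle1 n]) (by linarith) ht.2 (by linarith) (hn n)
  rw [hKs] at hQn
  refine hQ t _ _ ?_ hQn
  have hsum : ∑ i ∈ Finset.range (n + 1), r ^ i ≤ (1 - r)⁻¹ := by
    rw [← tsum_geometric_of_lt_one hr0 hr1]
    exact (summable_geometric_of_lt_one hr0 hr1).sum_le_tsum _ fun i _ => by positivity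
  simp only [hK]
  gcongr

end Iteration

section VortexSegments

variable {T T₀ : ℝ} {u : ℝ → E3 → E3} {p : ℝ → E3 → ℝ} {γ : ℝ → ℝ → E3} {ℓ : ℝ → ℝ}
  {X : E3 → ℝ → ℝ → E3}

/-- The vortex line segment at time `t`. -/
def segm (γ : ℝ → ℝ → E3) (ℓ : ℝ → ℝ) (t : ℝ) : Set E3 := γ t '' Icc 0 (ℓ t)

/-- A family of vortex line segments `L_t` transported by the flow `X` with
`X(L_{t₁},t₁,t₂) ⊇ L_{t₂}`. -/
structure IsTransportedSegment (T T₀ : ℝ) (u : ℝ → E3 → E3) (γ : ℝ → ℝ → E3) (ℓ : ℝ → ℝ)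
    (X : E3 → ℝ → ℝ → E3) : Prop where
  nonneg : 0 ≤ T₀
  tangent : ∀ t ∈ Ico T₀ T, ∀ s ∈ Icc 0 (ℓ t), HasDerivAt (γ t) (xiOf (u t) (γ t s)) s
  ne_zero : ∀ t ∈ Ico T₀ T, ∀ x ∈ segm γ ℓ t, curl3 (u t) x ≠ 0
  flow_self : ∀ q : E3, ∀ t₁ ∈ Ico 0 T, X q t₁ t₁ = q
  flow : ∀ q : E3, ∀ t₁ ∈ Ico 0 T, ∀ t₂ ∈ Ico 0 T,
    HasDerivAt (fun τ => X q t₁ τ) (u t₂ (X q t₁ t₂)) t₂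
  subset : ∀ t₁ t₂ : ℝ, T₀ < t₁ → t₁ < t₂ → t₂ < T →
    segm γ ℓ t₂ ⊆ (fun q => X q t₁ t₂) '' segm γ ℓ t₁

namespace IsTransportedSegment

variable (h : IsTransportedSegment T T₀ u γ ℓ X)
  (hu : ContDiffOn ℝ (⊤ : ℕ∞) (fun q : ℝ × E3 => u q.1 q.2) (slab T))

include h

theorem isCompact_segm {t : ℝ} (ht : t ∈ Ico T₀ T) : IsCompact (segm γ ℓ t) :=
  isCompact_Icc.image_of_continuousOn fun s hs => (h.tangent t ht s hs).continuousAt.continuousWithinAt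

include hu

/-- Points of the later segment were on the earlier segments. -/
theorem backward_mem {t t₂ : ℝ} (ht : T₀ < t) (htt₂ : t ≤ t₂) (ht₂ : t₂ < T) {x : E3}
    (hx : x ∈ segm γ ℓ t₂) : X x t₂ t ∈ segm γ ℓ t := by
  have h0 := h.nonneg
  have htI : t ∈ Ico 0 T := ⟨by linarith, by linarith⟩
  have ht₂I : t₂ ∈ Ico 0 T := ⟨by linarith, ht₂⟩
  rcases htt₂.eq_or_lt with rfl | hlt
  · rwa [h.flow_self x t htI]
  obtain ⟨q, hq, hqx⟩ := h.subset t t₂ ht hlt ht₂ hx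
  have huniq := trajectory_unique (V := fun q : ℝ × E3 => u q.1 q.2) (T₁ := 0) (T₂ := T)
    (t₁ := t) (t₂ := t₂) (z₀ := X q t) (z := X x t₂)
    (hu.of_le (by exact WithTop.coe_le_coe.2 (le_top (a := (2 : ℕ∞)))))
    (fun r hr => ⟨by linarith [hr.1], by linarith [hr.2]⟩)
    (fun r hr => h.flow q t htI r (Ioo_subset_Ico_self hr))
    (fun r hr => h.flow x t₂ ht₂I r (Ioo_subset_Ico_self hr))
    (by rw [h.flow_self x t₂ ht₂I]; exact hqx.symm) t (left_mem_Icc.2 htt₂)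
  rwa [huniq, h.flow_self q t htI]

variable (hp : ContDiffOn ℝ (⊤ : ℕ∞) (fun q : ℝ × E3 => p q.1 q.2) (slab T))
  (heuler : ∀ t ∈ Ioo 0 T, ∀ z : E3, EulerEqnAt u p t z)

include hp heuler

theorem norm_curl_le_of_bound {t₁ t₂ η l m P K : ℝ} (ht₁ : T₀ < t₁) (h12 : t₁ ≤ t₂) (ht₂ : t₂ < T)
    (hη : 0 < η) (hηl : η ≤ l) (hl : l ≤ ℓ t₂)
    (hU : ∀ t ∈ Icc t₁ t₂, Uxi (u t) (segm γ ℓ t) ≤ P)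
    (hUM : ∀ t ∈ Icc t₁ t₂, Un (u t) (segm γ ℓ t) * Mdhy (u t) (segm γ ℓ t) * l ≤ P)
    (hM : ∀ t ∈ Icc t₁ t₂, Mdhy (u t) (segm γ ℓ t) ≤ m)
    (hx : P / η * (t₂ - t₁) ≤ 1 / 4) (hK : ∀ x ∈ segm γ ℓ t₁, ‖curl3 (u t₁) x‖ ≤ K) :
    ∀ x ∈ segm γ ℓ t₂,
      ‖curl3 (u t₂) x‖ ≤ Real.exp (4 * (P / η * (t₂ - t₁)) + 3 * (m * η)) * K := by
  have h0 := h.nonneg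
  have ht₂I : t₂ ∈ Ico 0 T := ⟨by linarith, ht₂⟩
  rintro _ ⟨s, hs, rfl⟩
  set a := min s (ℓ t₂ - η) with ha
  have ha0 : 0 ≤ a := le_min hs.1 (by linarith)
  have hb : a + η ≤ ℓ t₂ := by linarith [min_le_right s (ℓ t₂ - η)]
  have hsub : Icc a (a + η) ⊆ Icc 0 (ℓ t₂) := Icc_subset_Icc ha0 hb
  have hsm : s ∈ Icc a (a + η) := by
    refine ⟨min_le_left _ _, ?_⟩
    rcases min_cases s (ℓ t₂ - η) with ⟨e, -⟩ | ⟨e, -⟩ <;> rw [ha, e] <;> linarith [hs.2]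
  have hmem : ∀ s ∈ Icc a (a + η), ∀ t ∈ Icc t₁ t₂, X (γ t₂ s) t₂ t ∈ segm γ ℓ t :=
    fun s hs t ht => h.backward_mem hu (ht₁.trans_le ht.1) ht.2 ht₂ ⟨s, hsub hs, rfl⟩
  have hT : ∀ t ∈ Icc t₁ t₂, t ∈ Ico T₀ T := fun t ht => ⟨by linarith [ht.1], by linarith [ht.2]⟩
  have hsheet : IsVortexSheet T u (fun s t => X (γ t₂ s) t₂ t) a (a + η) t₁ t₂ := by
    refine ⟨by linarith, h12, fun t ht => ⟨by linarith [ht.1], by linarith [ht.2]⟩,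
      fun s t ht => h.flow _ t₂ ht₂I t (Ioo_subset_Ico_self ht), fun s hs => ?_,
      fun s hs t ht => h.ne_zero t (hT t ht) _ (hmem s hs t ht)⟩
    simp only [h.flow_self _ t₂ ht₂I]
    exact h.tangent t₂ (hT t₂ (right_mem_Icc.2 h12)) s (hsub hs)
  have := hsheet.norm_curl_le hu hp heuler (L := segm γ ℓ) (ℓ := l) (m := m) (P := P)
    (by linarith) (by linarith) (fun t ht => h.isCompact_segm (hT t ht))
    (fun t ht => h.ne_zero t (hT t ht)) hmem hU hUM hM (by rwa [add_sub_cancel_left]) hsm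
  rw [add_sub_cancel_left] at this
  simp only [h.flow_self _ t₂ ht₂I] at this
  refine this.trans ?_
  gcongr
  exact hK _ (hmem s hsm t₁ (left_mem_Icc.2 h12))

/-- Under the Deng–Hou–Yu scaling assumptions the vorticity on the segments grows by at most a
factor `exp (C (T - t₁) ^ ε)` while the distance to `T` is at most halved. -/
theorem norm_curl_le_of_rates {A B D c_A c_B C₀ t₁ t₂ K : ℝ} (hA : A ∈ Ioo (0 : ℝ) 1)
    (hD : D ∈ Icc (0 : ℝ) 1) (hBD : B ≤ D) (hcA : 0 < c_A) (hcB : 0 < c_B) (hC₀ : 0 < C₀)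
    (hℓ : ∀ t ∈ Ico T₀ T, 0 ≤ ℓ t)
    (ha : ∀ t ∈ Ico T₀ T, Uxi (u t) (segm γ ℓ t) +
      Un (u t) (segm γ ℓ t) * Mdhy (u t) (segm γ ℓ t) * ℓ t ≤ c_A * (T - t) ^ (-A))
    (hb : ∀ t ∈ Ico T₀ T, Mdhy (u t) (segm γ ℓ t) * ℓ t ≤ C₀)
    (hc : ∀ t ∈ Ico T₀ T, c_B * (T - t) ^ B ≤ ℓ t)
    (ht₁ : T₀ < t₁) (h12 : t₁ ≤ t₂) (ht₂ : t₂ < T) (hhalf : (T - t₁) / 2 ≤ T - t₂)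
    (hone : T - t₁ ≤ 1) (hε₁ : c_A * (T - t₁) ^ ((1 - A - D) / 2) ≤ 1 / 4)
    (hε₂ : (T - t₁) ^ ((1 - A - D) / 2) ≤ c_B / 2)
    (hK : ∀ x ∈ segm γ ℓ t₁, ‖curl3 (u t₁) x‖ ≤ K) :
    ∀ x ∈ segm γ ℓ t₂, ‖curl3 (u t₂) x‖ ≤
      Real.exp ((4 * c_A + 3 * (C₀ / (c_B / 2))) * (T - t₁) ^ ((1 - A - D) / 2)) * K := by
  set δ := T - t₁ with hδ
  set ε := (1 - A - D) / 2 with hε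
  have hδ0 : 0 < δ := by linarith
  set η := δ ^ (D + ε) with hη
  set l := c_B / 2 * δ ^ D with hl
  set P := 2 * c_A * δ ^ (-A) with hP
  have hηpos : 0 < η := Real.rpow_pos_of_pos hδ0 _
  have hδD : 0 < δ ^ D := Real.rpow_pos_of_pos hδ0 _
  have hlpos : 0 < l := by positivity
  have hηD : η = δ ^ D * δ ^ ε := Real.rpow_add hδ0 _ _
  have hT : ∀ t ∈ Icc t₁ t₂, t ∈ Ico T₀ T := fun t ht => ⟨by linarith [ht.1], by linarith [ht.2]⟩
  have hηl : η ≤ l := by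
    rw [hηD, hl, mul_comm]
    gcongr
  have htwo : ∀ c : ℝ, c ≤ 1 → (2 : ℝ) ^ c ≤ 2 := fun c hc => by
    simpa using Real.rpow_le_rpow_of_exponent_le (x := 2) (by norm_num) hc
  have hll : ∀ t ∈ Icc t₁ t₂, l ≤ ℓ t := by
    intro t ht
    have h1 : δ / 2 ≤ T - t := by linarith [ht.2]
    have h2 : T - t ≤ 1 := by linarith [ht.1]
    have h3 : δ ^ D / 2 ≤ (T - t) ^ B :=
      calc δ ^ D / 2 ≤ δ ^ D / 2 ^ D := by
            gcongr
            exact htwo D hD.2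
        _ = (δ / 2) ^ D := (Real.div_rpow hδ0.le (by norm_num) _).symm
        _ ≤ (T - t) ^ D := Real.rpow_le_rpow (by linarith) h1 hD.1
        _ ≤ (T - t) ^ B := Real.rpow_le_rpow_of_exponent_ge (by linarith) h2 hBD
    calc l = c_B * (δ ^ D / 2) := by rw [hl]; ring
      _ ≤ c_B * (T - t) ^ B := by gcongr
      _ ≤ ℓ t := hc t (hT t ht)
  have hPt : ∀ t ∈ Icc t₁ t₂, c_A * (T - t) ^ (-A) ≤ P := by
    intro t ht
    have h1 : δ / 2 ≤ T - t := by linarith [ht.2]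
    have h2 : (T - t) ^ (-A) ≤ 2 * δ ^ (-A) :=
      calc (T - t) ^ (-A) ≤ (δ / 2) ^ (-A) :=
            Real.rpow_le_rpow_of_nonpos (by linarith) h1 (by linarith [hA.1])
        _ = 2 ^ A * δ ^ (-A) := by
            rw [Real.div_rpow hδ0.le (by norm_num), Real.rpow_neg (by norm_num : (0:ℝ) ≤ 2),
              div_inv_eq_mul, mul_comm]
        _ ≤ 2 * δ ^ (-A) := by
            gcongr
            exact htwo A hA.2.le
    calc c_A * (T - t) ^ (-A) ≤ c_A * (2 * δ ^ (-A)) := by gcongr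
      _ = P := by rw [hP]; ring
  have hPpos : 0 < P := by positivity
  have hPη : P / η * (δ / 2) = c_A * δ ^ ε := by
    have e : δ ^ ε * η = δ ^ (-A) * δ := by
      have : δ ^ (-A) * δ = δ ^ (-A + 1) := by rw [Real.rpow_add hδ0, Real.rpow_one]
      rw [this, hη, ← Real.rpow_add hδ0, hε]
      ring_nf
    rw [hP]
    field_simp
    linear_combination -e
  have hxle : P / η * (t₂ - t₁) ≤ c_A * δ ^ ε := by
    rw [← hPη]
    gcongr
    linarith
  have hηm : C₀ / l * η = C₀ / (c_B / 2) * δ ^ ε := by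
    rw [hηD, hl]
    field_simp
  have hUM0 : ∀ t, 0 ≤ Un (u t) (segm γ ℓ t) * Mdhy (u t) (segm γ ℓ t) := fun t =>
    mul_nonneg (Un_nonneg _ _) (Mdhy_nonneg _ _)
  have hKn : 0 ≤ K := by
    have : (0 : ℝ) ≤ ‖curl3 (u t₁) (γ t₁ 0)‖ := norm_nonneg _
    exact this.trans (hK _ ⟨0, left_mem_Icc.2 (hℓ t₁ ⟨ht₁.le, by linarith⟩), rfl⟩)
  intro x hx
  refine (h.norm_curl_le_of_bound hu hp heuler ht₁ h12 ht₂ hηpos hηl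
    (hll t₂ (right_mem_Icc.2 h12)) (P := P) (m := C₀ / l) ?_ ?_ ?_ (hxle.trans hε₁) hK x hx).trans ?_
  · intro t ht
    have := mul_nonneg (hUM0 t) (hℓ t (hT t ht))
    linarith [ha t (hT t ht), hPt t ht]
  · intro t ht
    have := mul_le_mul_of_nonneg_left (hll t ht) (hUM0 t)
    linarith [ha t (hT t ht), hPt t ht, Uxi_nonneg (u t) (segm γ ℓ t)]
  · intro t ht
    rw [le_div_iff₀ hlpos]
    exact (mul_le_mul_of_nonneg_left (hll t ht) (Mdhy_nonneg _ _)).trans (hb t (hT t ht))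
  · rw [hηm]
    gcongr
    linarith

end IsTransportedSegment

end VortexSegments

/-- **Deng–Hou–Yu non-blowup criterion (second part).**
`u` is a smooth solution of the 3D incompressible Euler equations on `ℝ³ × [0,T)`.  For
`t ∈ [T₀,T)`, `γ t : [0, ℓ t] → ℝ³` is an arc-length parametrization of a vortex line segment
`L_t = γ t '' [0, ℓ t]` (its unit tangent is the vorticity direction `ξ`, and `ω ≠ 0` on it),
so that `L(t) = ℓ t` is the arc length of `L_t`.  `X(·,t₁,t₂)` is the flow map from time `t₁`
to time `t₂` and `X(L_{t₁},t₁,t₂) ⊇ L_{t₂}` for `T₀ < t₁ < t₂ < T`.  `‖ω(·,t)‖_∞` is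
monotonically increasing and `‖ω(·,t)‖_{L^∞(L_t)} ≥ c₀ ‖ω(·,t)‖_∞` for `t` close to `T`.
If (a) `U_ξ(t) + U_n(t) M(t) L(t) ≤ c_A (T−t)^{−A}` with `A ∈ (0,1)`,
(b) `M(t) L(t) ≤ C₀`, and (c) `L(t) ≥ c_B (T−t)^{B}` with `B < 1 − A`, then `‖ω(·,t)‖_∞`
remains bounded up to time `T`. -/
theorem deng_hou_yu_second
    (T T₀ : ℝ) (hT₀ : 0 ≤ T₀) (hT₀T : T₀ < T)
    (u : ℝ → E3 → E3) (p : ℝ → E3 → ℝ)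
    (husmooth : ∀ i : Fin 3,
      ContDiffOn ℝ (⊤ : ℕ∞) (fun q : ℝ × E3 => u q.1 q.2 i) (Set.Ico 0 T ×ˢ Set.univ))
    (hpsmooth : ContDiffOn ℝ (⊤ : ℕ∞) (fun q : ℝ × E3 => p q.1 q.2) (Set.Ico 0 T ×ˢ Set.univ))
    (heuler : ∀ t ∈ Set.Ico 0 T, ∀ z : E3, EulerEqnAt u p t z)
    -- the family of vortex line segments `L_t = γ t '' [0, ℓ t]`, parametrized by arc length
    (γ : ℝ → ℝ → E3) (ℓ : ℝ → ℝ)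
    (hℓ : ∀ t ∈ Set.Ico T₀ T, 0 ≤ ℓ t)
    (hγtangent : ∀ t ∈ Set.Ico T₀ T, ∀ s ∈ Set.Icc 0 (ℓ t),
      HasDerivAt (γ t) (xiOf (u t) (γ t s)) s)
    (hωne : ∀ t ∈ Set.Ico T₀ T, ∀ x ∈ γ t '' Set.Icc 0 (ℓ t), curl3 (u t) x ≠ 0)
    -- the two-time flow map `X(q,t₁,t₂)`
    (X : E3 → ℝ → ℝ → E3)
    (hXinit : ∀ q : E3, ∀ t₁ ∈ Set.Ico 0 T, X q t₁ t₁ = q)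
    (hXflow : ∀ q : E3, ∀ t₁ ∈ Set.Ico 0 T, ∀ t₂ ∈ Set.Ico 0 T,
      HasDerivAt (fun τ => X q t₁ τ) (u t₂ (X q t₁ t₂)) t₂)
    -- the inclusion `X(L_{t₁},t₁,t₂) ⊇ L_{t₂}`
    (hincl : ∀ t₁ t₂ : ℝ, T₀ < t₁ → t₁ < t₂ → t₂ < T →
      γ t₂ '' Set.Icc 0 (ℓ t₂) ⊆ (fun q => X q t₁ t₂) '' (γ t₁ '' Set.Icc 0 (ℓ t₁)))
    -- monotonicity of the maximum vorticity
    (hmono : ∀ t₁ ∈ Set.Ico 0 T, ∀ t₂ ∈ Set.Ico 0 T, t₁ ≤ t₂ →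
      eLpNorm (curl3 (u t₁)) ⊤ volume ≤ eLpNorm (curl3 (u t₂)) ⊤ volume)
    -- the vorticity on `L_t` is comparable to the maximum vorticity for `t` close to `T`
    (c₀ : ℝ) (hc₀ : 0 < c₀)
    (hclose : ∃ T₁, T₀ ≤ T₁ ∧ T₁ < T ∧ ∀ t ∈ Set.Ico T₁ T,
      ENNReal.ofReal c₀ * eLpNorm (curl3 (u t)) ⊤ volume ≤
        ENNReal.ofReal (sSup ((fun x => ‖curl3 (u t) x‖) '' (γ t '' Set.Icc 0 (ℓ t)))))
    -- conditions (a), (b), (c)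
    (A B c_A c_B C₀ : ℝ) (hA : A ∈ Set.Ioo (0:ℝ) 1) (hB : B < 1 - A)
    (hcA : 0 < c_A) (hcB : 0 < c_B) (hC₀ : 0 < C₀)
    (ha : ∀ t ∈ Set.Ico T₀ T,
      Uxi (u t) (γ t '' Set.Icc 0 (ℓ t)) +
        Un (u t) (γ t '' Set.Icc 0 (ℓ t)) * Mdhy (u t) (γ t '' Set.Icc 0 (ℓ t)) * ℓ t ≤
      c_A * (T - t) ^ (-A))
    (hb : ∀ t ∈ Set.Ico T₀ T, Mdhy (u t) (γ t '' Set.Icc 0 (ℓ t)) * ℓ t ≤ C₀)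
    (hc : ∀ t ∈ Set.Ico T₀ T, c_B * (T - t) ^ B ≤ ℓ t) :
    ∃ K : ℝ, ∀ t ∈ Set.Ico 0 T, eLpNorm (curl3 (u t)) ⊤ volume ≤ ENNReal.ofReal K := by
  have hsub : slab T ⊆ Ico 0 T ×ˢ univ := prod_mono Ioo_subset_Ico_self subset_rfl
  have hu : ContDiffOn ℝ (⊤ : ℕ∞) (fun q : ℝ × E3 => u q.1 q.2) (slab T) :=
    contDiffOn_euclidean.2 fun i => (husmooth i).mono hsub
  have hp := hpsmooth.mono hsub
  have heuler' : ∀ t ∈ Ioo 0 T, ∀ z : E3, EulerEqnAt u p t z := fun t ht =>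
    heuler t (Ioo_subset_Ico_self ht)
  have hseg : IsTransportedSegment T T₀ u γ ℓ X :=
    ⟨hT₀, hγtangent, hωne, hXinit, hXflow, hincl⟩
  obtain ⟨T₁, hT₀₁, hT₁T, hclose⟩ := hclose
  set D := max B 0 with hD
  have hD0 : 0 ≤ D := le_max_right _ _
  have hDA : D < 1 - A := max_lt hB (by linarith [hA.2])
  set ε := (1 - A - D) / 2 with hε
  have hε0 : 0 < ε := by linarith
  set y := min (1 / (4 * c_A)) (c_B / 2) with hy
  have hy0 : 0 < y := lt_min (by positivity) (by positivity)
  set δ := min (min 1 ((T - T₀) / 2)) (y ^ ε⁻¹) with hδ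
  have hδ0 : 0 < δ := lt_min (lt_min one_pos (by linarith)) (Real.rpow_pos_of_pos hy0 _)
  have hδ1 : δ ≤ 1 := (min_le_left _ _).trans (min_le_left _ _)
  have hδ2 : δ ≤ (T - T₀) / 2 := (min_le_left _ _).trans (min_le_right _ _)
  have hδy : δ ^ ε ≤ y :=
    (Real.rpow_le_rpow hδ0.le (min_le_right _ _) hε0.le).trans_eq
      (Real.rpow_inv_rpow hy0.le hε0.ne')
  have hI : T - δ ∈ Ico T₀ T := ⟨by linarith, by linarith⟩
  obtain ⟨K₀, hK₀⟩ := (hseg.isCompact_segm hI).exists_bound_of_continuousOn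
    (contDiff_curl_slice hu ⟨by linarith, hI.2⟩).continuous.continuousOn
  obtain ⟨K, hK⟩ := exists_bound_of_dyadic_steps
    (Q := fun K t => ∀ x ∈ segm γ ℓ t, ‖curl3 (u t) x‖ ≤ K) (T := T)
    (C := 4 * c_A + 3 * (C₀ / (c_B / 2))) (K₀ := max K₀ 0) (by positivity) hε0 hδ0
    (le_max_right _ _) (fun t K K' hKK' h x hx => (h x hx).trans hKK')
    (fun x hx => (hK₀ x hx).trans (le_max_left _ _))
    (fun t₁ t₂ K h₁ h₁₂ h₂ hhalf hKt => by
      have hpow : (T - t₁) ^ ε ≤ y :=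
        (Real.rpow_le_rpow (by linarith) (by linarith) hε0.le).trans hδy
      refine hseg.norm_curl_le_of_rates hu hp heuler' hA ⟨hD0, by linarith [hA.1]⟩
        (le_max_left _ _) hcA hcB hC₀ hℓ ha hb hc (by linarith) h₁₂ h₂ hhalf (by linarith) ?_
        (hpow.trans (min_le_right _ _)) hKt
      calc c_A * (T - t₁) ^ ε ≤ c_A * (1 / (4 * c_A)) := by
            gcongr
            exact hpow.trans (min_le_left _ _)
        _ = 1 / 4 := by field_simp)
  refine ⟨max K 0 / c₀, fun t ht => ?_⟩
  set t' := max t (max (T - δ) T₁) with ht'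
  have ht'T : t' < T := max_lt ht.2 (max_lt hI.2 hT₁T)
  have ht'δ : T - δ ≤ t' := (le_max_left _ _).trans (le_max_right _ _)
  have ht'1 : T₁ ≤ t' := (le_max_right _ _).trans (le_max_right _ _)
  refine (hmono t ht t' ⟨ht.1.trans (le_max_left _ _), ht'T⟩ (le_max_left _ _)).trans ?_
  rw [ENNReal.ofReal_div_of_pos hc₀, ENNReal.le_div_iff_mul_le
    (Or.inl (ENNReal.ofReal_pos.2 hc₀).ne') (Or.inl ENNReal.ofReal_ne_top), mul_comm]
  refine (hclose t' ⟨ht'1, ht'T⟩).trans (ENNReal.ofReal_le_ofReal ?_)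
  refine Real.sSup_le ?_ (le_max_right _ _)
  rintro _ ⟨x, hx, rfl⟩
  exact (hK t' ⟨ht'δ, ht'T⟩ x hx).trans (le_max_left _ _)
end
end

section
/- Let u^θ, ω^θ, ψ^θ be smooth functions of (r,z,t) on (0,∞) × ℝ × [0,T) satisfying the axisymmetric Euler equations: u^θ_t + u^r u^θ_r + u^z u^θ_z = −(1/r) u^r u^θ, ω^θ_t + u^r ω^θ_r + u^z ω^θ_z = (2/r) u^θ u^θ_z + (1/r) u^r ω^θ, and −[∂_r² + (1/r)∂_r + ∂_z² − 1/r²] ψ^θ = ω^θ, where u^r = −ψ^θ_z and u^z = (1/r)(rψ^θ)_r. Define u₁ = u^θ/r, ω₁ = ω^θ/r, ψ₁ = ψ^θ/r. Then for all r > 0 these transformed variables satisfy: u₁,t + u^r u₁,r + u^z u₁,z = 2 u₁ ψ₁,z; ω₁,t + u^r ω₁,r + u^z ω₁,z = (u₁²)_z; −[∂_r² + (3/r)∂_r + ∂_z²] ψ₁ = ω₁; and u^r = −r ψ₁,z, u^z = 2ψ₁ + r ψ₁,r. -/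
open Set

noncomputable section

/-- partial derivative in `r` of a function of `(r,z,t)`. -/
def dR (f : ℝ → ℝ → ℝ → ℝ) (r z t : ℝ) : ℝ := deriv (fun r' => f r' z t) r
/-- partial derivative in `z` of a function of `(r,z,t)`. -/
def dZ (f : ℝ → ℝ → ℝ → ℝ) (r z t : ℝ) : ℝ := deriv (fun z' => f r z' t) z
/-- partial derivative in `t` of a function of `(r,z,t)`. -/
def dT (f : ℝ → ℝ → ℝ → ℝ) (r z t : ℝ) : ℝ := deriv (fun t' => f r z t') t
/-- second partial derivative in `r`. -/
def dRR (f : ℝ → ℝ → ℝ → ℝ) (r z t : ℝ) : ℝ := deriv (fun r' => dR f r' z t) r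
/-- second partial derivative in `z`. -/
def dZZ (f : ℝ → ℝ → ℝ → ℝ) (r z t : ℝ) : ℝ := deriv (fun z' => dZ f r z' t) z

/-- The slice in `r` of a function smooth on `(0,∞) × ℝ × I` is smooth on `(0,∞)`. -/
lemma contDiffOn_radial_slice {n : WithTop ℕ∞} {f : ℝ → ℝ → ℝ → ℝ} {I : Set ℝ}
    (hf : ContDiffOn ℝ n (fun q : ℝ × ℝ × ℝ => f q.1 q.2.1 q.2.2)
      (Set.Ioi (0 : ℝ) ×ˢ (Set.univ : Set ℝ) ×ˢ I)) (z : ℝ) {t : ℝ} (ht : t ∈ I) :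
    ContDiffOn ℝ n (fun r => f r z t) (Set.Ioi (0 : ℝ)) :=
  hf.comp (f := fun r : ℝ => (r, z, t)) (by fun_prop) fun _ hr => ⟨hr, Set.mem_univ _, ht⟩

/-- The slice in `z` of a function smooth on `(0,∞) × ℝ × I` is smooth. -/
lemma contDiff_axial_slice {n : WithTop ℕ∞} {f : ℝ → ℝ → ℝ → ℝ} {I : Set ℝ}
    (hf : ContDiffOn ℝ n (fun q : ℝ × ℝ × ℝ => f q.1 q.2.1 q.2.2)
      (Set.Ioi (0 : ℝ) ×ˢ (Set.univ : Set ℝ) ×ˢ I)) {r t : ℝ} (hr : 0 < r) (ht : t ∈ I) :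
    ContDiff ℝ n (fun z => f r z t) :=
  contDiffOn_univ.1 <|
    hf.comp (f := fun z : ℝ => (r, z, t)) (by fun_prop) fun _ _ => ⟨hr, Set.mem_univ _, ht⟩

lemma hasDerivAt_dR {f : ℝ → ℝ → ℝ → ℝ} {r z t : ℝ}
    (hf : ContDiffOn ℝ (⊤ : ℕ∞) (fun r' => f r' z t) (Set.Ioi (0 : ℝ))) (hr : 0 < r) :
    HasDerivAt (fun r' => f r' z t) (dR f r z t) r :=
  ((hf.contDiffAt (Ioi_mem_nhds hr)).differentiableAt (by simp)).hasDerivAt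

lemma hasDerivAt_dRR {f : ℝ → ℝ → ℝ → ℝ} {r z t : ℝ}
    (hf : ContDiffOn ℝ (⊤ : ℕ∞) (fun r' => f r' z t) (Set.Ioi (0 : ℝ))) (hr : 0 < r) :
    HasDerivAt (fun r' => dR f r' z t) (dRR f r z t) r := by
  have h : ContDiffOn ℝ 1 (fun r' => dR f r' z t) (Set.Ioi (0 : ℝ)) :=
    hf.deriv_of_isOpen isOpen_Ioi (by norm_cast)
  exact ((h.contDiffAt (Ioi_mem_nhds hr)).differentiableAt (by simp)).hasDerivAt

lemma dT_div_radius (f : ℝ → ℝ → ℝ → ℝ) (r z t : ℝ) :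
    dT (fun r z t => f r z t / r) r z t = dT f r z t / r :=
  deriv_div_const _

lemma dZ_div_radius (f : ℝ → ℝ → ℝ → ℝ) (r z t : ℝ) :
    dZ (fun r z t => f r z t / r) r z t = dZ f r z t / r :=
  deriv_div_const _

lemma dZZ_div_radius (f : ℝ → ℝ → ℝ → ℝ) (r z t : ℝ) :
    dZZ (fun r z t => f r z t / r) r z t = dZZ f r z t / r := by
  simp only [dZZ, dZ_div_radius]
  exact deriv_div_const _

lemma dR_div_radius {f : ℝ → ℝ → ℝ → ℝ} {r z t : ℝ}
    (hf : ContDiffOn ℝ (⊤ : ℕ∞) (fun r' => f r' z t) (Set.Ioi (0 : ℝ))) (hr : 0 < r) :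
    dR (fun r z t => f r z t / r) r z t = (dR f r z t * r - f r z t) / r ^ 2 := by
  refine ((hasDerivAt_dR hf hr).fun_div (hasDerivAt_id' r) hr.ne').deriv.trans ?_
  rw [mul_one]

lemma dRR_div_radius {f : ℝ → ℝ → ℝ → ℝ} {r z t : ℝ}
    (hf : ContDiffOn ℝ (⊤ : ℕ∞) (fun r' => f r' z t) (Set.Ioi (0 : ℝ))) (hr : 0 < r) :
    dRR (fun r z t => f r z t / r) r z t
      = dRR f r z t / r - 2 * dR f r z t / r ^ 2 + 2 * f r z t / r ^ 3 := by
  have hev : (fun r' => dR (fun r z t => f r z t / r) r' z t) =ᶠ[nhds r]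
      fun r' => (dR f r' z t * r' - f r' z t) / r' ^ 2 := by
    filter_upwards [Ioi_mem_nhds hr] with r' hr'
    exact dR_div_radius hf hr'
  have h := (((hasDerivAt_dRR hf hr).mul (hasDerivAt_id r)).sub (hasDerivAt_dR hf hr)).div
    ((hasDerivAt_id r).pow 2) (pow_ne_zero 2 hr.ne')
  refine hev.deriv_eq.trans (h.deriv.trans ?_)
  simp only [id, Pi.mul_apply, Pi.sub_apply, Pi.pow_apply]
  field_simp
  norm_num
  ring

/-- **Hou–Li transformation of the axisymmetric Euler equations.**
Smooth `u^θ, ω^θ, ψ^θ` on `(0,∞) × ℝ × [0,T)` satisfy the axisymmetric Euler equations (with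
`u^r = −ψ^θ_z`, `u^z = (1/r)(rψ^θ)_r`).  Then `u₁ = u^θ/r`, `ω₁ = ω^θ/r`, `ψ₁ = ψ^θ/r`
satisfy the transformed equations
`u₁,t + u^r u₁,r + u^z u₁,z = 2u₁ψ₁,z`, `ω₁,t + u^r ω₁,r + u^z ω₁,z = (u₁²)_z`,
`−[∂_r² + (3/r)∂_r + ∂_z²]ψ₁ = ω₁`, and `u^r = −rψ₁,z`, `u^z = 2ψ₁ + rψ₁,r` for all `r > 0`. -/
theorem hou_li_transformed_equations
    (T : ℝ) (hT : 0 < T)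
    (uθ ωθ ψθ : ℝ → ℝ → ℝ → ℝ)
    (huθ : ContDiffOn ℝ (⊤ : ℕ∞) (fun q : ℝ × ℝ × ℝ => uθ q.1 q.2.1 q.2.2)
      (Set.Ioi (0:ℝ) ×ˢ (Set.univ : Set ℝ) ×ˢ Set.Ico 0 T))
    (hωθ : ContDiffOn ℝ (⊤ : ℕ∞) (fun q : ℝ × ℝ × ℝ => ωθ q.1 q.2.1 q.2.2)
      (Set.Ioi (0:ℝ) ×ˢ (Set.univ : Set ℝ) ×ˢ Set.Ico 0 T))
    (hψθ : ContDiffOn ℝ (⊤ : ℕ∞) (fun q : ℝ × ℝ × ℝ => ψθ q.1 q.2.1 q.2.2)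
      (Set.Ioi (0:ℝ) ×ˢ (Set.univ : Set ℝ) ×ˢ Set.Ico 0 T))
    -- the radial and axial velocities recovered from the angular stream function
    (ur uz : ℝ → ℝ → ℝ → ℝ)
    (hur : ∀ r z t : ℝ, ur r z t = - dZ ψθ r z t)
    (huz : ∀ r z t : ℝ, uz r z t = (1 / r) * deriv (fun r' => r' * ψθ r' z t) r)
    -- the axisymmetric Euler equations
    (heq1 : ∀ r z t : ℝ, 0 < r → t ∈ Set.Ico 0 T →
      dT uθ r z t + ur r z t * dR uθ r z t + uz r z t * dZ uθ r z t
        = -(1 / r) * ur r z t * uθ r z t)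
    (heq2 : ∀ r z t : ℝ, 0 < r → t ∈ Set.Ico 0 T →
      dT ωθ r z t + ur r z t * dR ωθ r z t + uz r z t * dZ ωθ r z t
        = (2 / r) * uθ r z t * dZ uθ r z t + (1 / r) * ur r z t * ωθ r z t)
    (heq3 : ∀ r z t : ℝ, 0 < r → t ∈ Set.Ico 0 T →
      -(dRR ψθ r z t + (1 / r) * dR ψθ r z t + dZZ ψθ r z t - ψθ r z t / r ^ 2)
        = ωθ r z t)
    -- the transformed variables
    (u₁ ω₁ ψ₁ : ℝ → ℝ → ℝ → ℝ)
    (hu₁ : ∀ r z t : ℝ, u₁ r z t = uθ r z t / r)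
    (hω₁ : ∀ r z t : ℝ, ω₁ r z t = ωθ r z t / r)
    (hψ₁ : ∀ r z t : ℝ, ψ₁ r z t = ψθ r z t / r) :
    ∀ r z t : ℝ, 0 < r → t ∈ Set.Ico 0 T →
      (dT u₁ r z t + ur r z t * dR u₁ r z t + uz r z t * dZ u₁ r z t
          = 2 * u₁ r z t * dZ ψ₁ r z t) ∧
      (dT ω₁ r z t + ur r z t * dR ω₁ r z t + uz r z t * dZ ω₁ r z t
          = deriv (fun z' => (u₁ r z' t) ^ 2) z) ∧
      (-(dRR ψ₁ r z t + (3 / r) * dR ψ₁ r z t + dZZ ψ₁ r z t) = ω₁ r z t) ∧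
      (ur r z t = -r * dZ ψ₁ r z t) ∧
      (uz r z t = 2 * ψ₁ r z t + r * dR ψ₁ r z t) := by
  obtain rfl : u₁ = fun r z t => uθ r z t / r := by ext; exact hu₁ _ _ _
  obtain rfl : ω₁ = fun r z t => ωθ r z t / r := by ext; exact hω₁ _ _ _
  obtain rfl : ψ₁ = fun r z t => ψθ r z t / r := by ext; exact hψ₁ _ _ _
  intro r z t hr ht
  have hu := contDiffOn_radial_slice huθ z ht
  have hω := contDiffOn_radial_slice hωθ z ht
  have hψ := contDiffOn_radial_slice hψθ z ht
  have hr0 := hr.ne'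
  have e1 := heq1 r z t hr ht
  have e2 := heq2 r z t hr ht
  have e3 := heq3 r z t hr ht
  have eur := hur r z t
  have huz' : uz r z t = 1 / r * (ψθ r z t + r * dR ψθ r z t) := by
    rw [huz]
    rw [((hasDerivAt_id' r).fun_mul (hasDerivAt_dR hψ hr)).deriv, one_mul]
  have hsq : deriv (fun z' => (uθ r z' t / r) ^ 2) z
      = 2 * uθ r z t * dZ uθ r z t / r ^ 2 := by
    have hz : HasDerivAt (fun z' => uθ r z' t) (dZ uθ r z t) z :=
      ((contDiff_axial_slice huθ hr ht).differentiable (by simp) z).hasDerivAt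
    refine ((hz.div_const r).pow 2).deriv.trans ?_
    norm_num
    field_simp
  rw [dT_div_radius, dT_div_radius, dZ_div_radius, dZ_div_radius, dZ_div_radius, dZZ_div_radius,
    dR_div_radius hu hr, dR_div_radius hω hr, dR_div_radius hψ hr, dRR_div_radius hψ hr, hsq]
  refine ⟨?_, ?_, ?_, ?_, ?_⟩
  · have hdZ : dZ ψθ r z t = -ur r z t := by linarith
    rw [hdZ]
    field_simp at e1 ⊢
    linear_combination e1
  · field_simp at e2 ⊢
    linear_combination e2
  · simp only [← e3]
    field_simp
    ring
  · rw [eur]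
    field_simp
  · rw [huz']
    field_simp
    ring
end
end

section
/- Let u₁(r,z,t) and ψ₁(r,z,t) be sufficiently smooth (C² in (r,z), C¹ in t, with continuous mixed partials) on a neighborhood of (r,z) = (1,0) for t in an interval, both odd in z, with ψ₁(1,z,t) = 0 for all z and t. Assume u₁ satisfies the transport equation u₁,t + u^r u₁,r + u^z u₁,z = 2 u₁ ψ₁,z, where u^r = −r ψ₁,z and u^z = 2ψ₁ + r ψ₁,r. Then at the point (r,z) = (1,0): ∂_t (∂_z u₁)(1,0,t) = −(∂_r ∂_z ψ₁)(1,0,t) · (∂_z u₁)(1,0,t). In particular, whenever ∂_z u₁(1,0,t) ≠ 0, the logarithmic time derivative satisfies d/dt log|∂_z u₁(1,0,t)| = −ψ₁,rz(1,0,t). -/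
open Set

noncomputable section

/-- The mixed second partial derivatives of a function that is `C²` at `(a, b)` exist there
and agree. -/
theorem exists_hasDerivAt_mixed_partial {f : ℝ → ℝ → ℝ} {a b : ℝ}
    (hf : ContDiffAt ℝ 2 (Function.uncurry f) (a, b)) :
    ∃ c, HasDerivAt (fun y => deriv (fun x => f x y) a) c b ∧
      HasDerivAt (fun x => deriv (fun y => f x y) b) c a := by
  set F := Function.uncurry f with hF
  have hfst (x y : ℝ) (h : DifferentiableAt ℝ F (x, y)) :
      deriv (fun x' => f x' y) x = fderiv ℝ F (x, y) (1, 0) :=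
    (h.hasFDerivAt.comp_hasDerivAt (f := fun x' => (x', y)) x
      ((hasDerivAt_id x).prodMk (hasDerivAt_const x y))).deriv
  have hsnd (x y : ℝ) (h : DifferentiableAt ℝ F (x, y)) :
      deriv (fun y' => f x y') y = fderiv ℝ F (x, y) (0, 1) :=
    (h.hasFDerivAt.comp_hasDerivAt (f := fun y' => (x, y')) y
      ((hasDerivAt_const y x).prodMk (hasDerivAt_id y))).deriv
  have hdiff : ∀ᶠ q in nhds (a, b), DifferentiableAt ℝ F q :=
    (hf.eventually (by simp)).mono fun q hq => hq.differentiableAt (by norm_num)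
  have hD : HasFDerivAt (fderiv ℝ F) (fderiv ℝ (fderiv ℝ F) (a, b)) (a, b) :=
    ((hf.fderiv_right (m := 1) (by norm_num)).differentiableAt (by norm_num)).hasFDerivAt
  have hsymm : IsSymmSndFDerivAt ℝ F (a, b) := hf.isSymmSndFDerivAt (by simp)
  have hpathfst : HasDerivAt (fun x : ℝ => (x, b)) (1, 0) a :=
    (hasDerivAt_id a).prodMk (hasDerivAt_const a b)
  have hpathsnd : HasDerivAt (fun y : ℝ => (a, y)) (0, 1) b :=
    (hasDerivAt_const b a).prodMk (hasDerivAt_id b)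
  refine ⟨fderiv ℝ (fderiv ℝ F) (a, b) (0, 1) (1, 0), ?_, ?_⟩
  · have h := (hD.comp_hasDerivAt (f := fun y => (a, y)) b hpathsnd).clm_apply (hasDerivAt_const b ((1 : ℝ), (0 : ℝ)))
    refine HasDerivAt.congr_of_eventuallyEq (by simpa using h) ?_
    filter_upwards [hpathsnd.continuousAt.eventually hdiff] with y hy using hfst a y hy
  · rw [hsymm.eq]
    have h := (hD.comp_hasDerivAt (f := fun x => (x, b)) a hpathfst).clm_apply (hasDerivAt_const a ((0 : ℝ), (1 : ℝ)))
    refine HasDerivAt.congr_of_eventuallyEq (by simpa using h) ?_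
    filter_upwards [hpathfst.continuousAt.eventually hdiff] with x hx using hsnd x b hx

/-- **Vorticity dynamics at the corner.**  Let `u₁(r,z,t)`, `ψ₁(r,z,t)` be sufficiently smooth
(`C²`) on a neighborhood of `(r,z) = (1,0)` for `t` in an open interval `I`, both odd in `z`,
with `ψ₁(1,z,t) = 0`.  If `u₁` satisfies the transport equation
`u₁,t + u^r u₁,r + u^z u₁,z = 2u₁ψ₁,z` with `u^r = −rψ₁,z`, `u^z = 2ψ₁ + rψ₁,r`, then at
`(r,z) = (1,0)`: `∂_t(∂_z u₁)(1,0,t) = −ψ₁,rz(1,0,t) · ∂_z u₁(1,0,t)`; in particular, whenever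
`∂_z u₁(1,0,t) ≠ 0`, `d/dt log|∂_z u₁(1,0,t)| = −ψ₁,rz(1,0,t)`. -/
theorem corner_log_derivative_identity
    (u₁ ψ₁ : ℝ → ℝ → ℝ → ℝ)
    (ε : ℝ) (hε : 0 < ε) (I : Set ℝ) (hI : IsOpen I) (hIconn : I.OrdConnected)
    (hu₁ : ContDiffOn ℝ 2 (fun q : (ℝ × ℝ) × ℝ => u₁ q.1.1 q.1.2 q.2)
      (Metric.ball ((1:ℝ), (0:ℝ)) ε ×ˢ I))
    (hψ₁ : ContDiffOn ℝ 2 (fun q : (ℝ × ℝ) × ℝ => ψ₁ q.1.1 q.1.2 q.2)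
      (Metric.ball ((1:ℝ), (0:ℝ)) ε ×ˢ I))
    (hu₁odd : ∀ r z t : ℝ, u₁ r (-z) t = -u₁ r z t)
    (hψ₁odd : ∀ r z t : ℝ, ψ₁ r (-z) t = -ψ₁ r z t)
    (hnoflow : ∀ z t : ℝ, ψ₁ 1 z t = 0)
    (htransport : ∀ r z : ℝ, (r, z) ∈ Metric.ball ((1:ℝ), (0:ℝ)) ε → ∀ t ∈ I,
      deriv (fun t' => u₁ r z t') t
        + (-r * deriv (fun z' => ψ₁ r z' t) z) * deriv (fun r' => u₁ r' z t) r
        + (2 * ψ₁ r z t + r * deriv (fun r' => ψ₁ r' z t) r) * deriv (fun z' => u₁ r z' t) z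
      = 2 * u₁ r z t * deriv (fun z' => ψ₁ r z' t) z) :
    ∀ t ∈ I,
      (deriv (fun t' => deriv (fun z => u₁ 1 z t') 0) t
        = -(deriv (fun r => deriv (fun z => ψ₁ r z t) 0) 1) * deriv (fun z => u₁ 1 z t) 0) ∧
      (deriv (fun z => u₁ 1 z t) 0 ≠ 0 →
        deriv (fun t' => Real.log |deriv (fun z => u₁ 1 z t') 0|) t
          = -(deriv (fun r => deriv (fun z => ψ₁ r z t) 0) 1)) := by
  intro t ht
  have hmem : (((1 : ℝ), (0 : ℝ)), t) ∈ Metric.ball ((1 : ℝ), (0 : ℝ)) ε ×ˢ I :=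
    ⟨Metric.mem_ball_self hε, ht⟩
  have hnhds := (Metric.isOpen_ball.prod hI).mem_nhds hmem
  have hu := hu₁.contDiffAt hnhds
  have hψ := hψ₁.contDiffAt hnhds
  have huzt : ContDiffAt ℝ 2 (Function.uncurry fun z t' => u₁ 1 z t') (0, t) :=
    hu.comp (f := fun p : ℝ × ℝ => (((1 : ℝ), p.1), p.2)) (0, t) (by fun_prop)
  have hψrz : ContDiffAt ℝ 2 (Function.uncurry fun r z => ψ₁ r z t) (1, 0) :=
    hψ.comp (f := fun p : ℝ × ℝ => (p, t)) (1, 0) (by fun_prop)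
  have huz : ContDiffAt ℝ 2 (Function.uncurry fun x z => u₁ 1 (x + z) t) (0, 0) := by
    have hu' : ContDiffAt ℝ 2 (fun q : (ℝ × ℝ) × ℝ => u₁ q.1.1 q.1.2 q.2)
        (((1 : ℝ), (0 : ℝ) + 0), t) := by simpa using hu
    exact hu'.comp (f := fun p : ℝ × ℝ => (((1 : ℝ), p.1 + p.2), t)) (0, 0) (by fun_prop)
  obtain ⟨c, huc, huc'⟩ := exists_hasDerivAt_mixed_partial huzt
  obtain ⟨d, hψd, hψd'⟩ := exists_hasDerivAt_mixed_partial hψrz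
  obtain ⟨e, hue, -⟩ := exists_hasDerivAt_mixed_partial huz
  simp only [deriv_comp_add_const (fun z => u₁ 1 z t), zero_add] at hue
  have hψzero (r : ℝ) : ψ₁ r 0 t = 0 := by
    have h := hψ₁odd r 0 t
    rw [neg_zero] at h
    linarith
  have hwall : (fun z => deriv (fun t' => u₁ 1 z t') t
      + deriv (fun r => ψ₁ r z t) 1 * deriv (fun z' => u₁ 1 z' t) z) =ᶠ[nhds 0] fun _ => 0 := by
    have hpath : ContinuousAt (fun z : ℝ => ((1 : ℝ), z)) 0 := by fun_prop
    filter_upwards [hpath.eventually (Metric.ball_mem_nhds _ hε)] with z hz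
    have h := htransport 1 z hz t ht
    simp only [hnoflow, deriv_const] at h
    linarith
  have hc : c = -d * deriv (fun z => u₁ 1 z t) 0 := by
    have h := (huc'.add (hψd.mul hue)).unique
      ((hasDerivAt_const (0 : ℝ) (0 : ℝ)).congr_of_eventuallyEq hwall)
    simp only [hψzero, deriv_const] at h
    linarith
  rw [huc.deriv, hψd'.deriv]
  refine ⟨hc, fun hne => ?_⟩
  simp only [Real.log_abs]
  rw [(huc.log hne).deriv, hc, mul_div_cancel_right₀ _ hne]
end
end
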